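/- arXiv:1805.10237 — 2 statements merged into one kernel-verified Lean document; each statement's English description precedes it below -/
import Mathlib

section
/- (Van Kampen–Flores theorem.) Let k be a positive integer and let f be a continuous map from the standard simplex Δ_{2k+2} = stdSimplex ℝ (Fin (2k+3)) to EuclideanSpace ℝ (Fin (2k)). Then there exist two disjoint subsets A, B ⊆ Fin (2k+3), each of cardinality k+1 (so the corresponding faces are k-dimensional), such that f '' {x ∈ Δ_{2k+2} : ∀ i ∉ A, x i = 0} ∩ f '' {x ∈ Δ_{2k+2} : ∀ i ∉ B, x i = 0} is nonempty. -/
namespace BorsukUlam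

/-- The simplicial coboundary, modulo two, of a cochain on lists of vertices. -/
def coboundary {α : Type*} : (List α → ZMod 2) → List α → ZMod 2
  | _, [] => 0
  | φ, a :: l => φ l + coboundary (fun m => φ (a :: m)) l

/-- Pullback of a cochain along the iterated-cone subdivision whose cone points are given
by `b`; with `b` the centroid this is barycentric subdivision of simplices with `n` vertices. -/
def subdiv {α : Type*} (b : List α → α) : ℕ → (List α → ZMod 2) → List α → ZMod 2
  | 0, φ, l => φ l
  | n + 1, φ, l => coboundary (subdiv b n fun m => φ (b l :: m)) l

/-- Evaluation of a cochain on the fundamental cycle of the cross-polytope with vertices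
`± e i`, `i < n`. -/
def crossSum {α : Type*} [Neg α] (e : ℕ → α) : ℕ → (List α → ZMod 2) → ZMod 2
  | 0, φ => φ []
  | n + 1, φ => crossSum e n (fun m => φ (e n :: m)) + crossSum e n (fun m => φ (-e n :: m))

section Coboundary

variable {α β : Type*}

lemma coboundary_add (φ ψ : List α → ZMod 2) (l : List α) :
    coboundary (fun m => φ m + ψ m) l = coboundary φ l + coboundary ψ l := by
  induction l generalizing φ ψ with
  | nil => simp [coboundary]
  | cons a l ih => simp only [coboundary, ih]; ring

lemma coboundary_zero (l : List α) : coboundary (fun _ => 0) l = 0 := by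
  induction l with
  | nil => rfl
  | cons a l ih => simp [coboundary, ih]

lemma coboundary_coboundary (φ : List α → ZMod 2) (l : List α) :
    coboundary (coboundary φ) l = 0 := by
  induction l generalizing φ with
  | nil => rfl
  | cons a l ih =>
    simp only [coboundary, coboundary_add, ih, add_zero]
    exact CharTwo.add_self_eq_zero _

lemma coboundary_map (f : α → β) (φ : List β → ZMod 2) (l : List α) :
    coboundary (fun m => φ (m.map f)) l = coboundary φ (l.map f) := by
  induction l generalizing φ with
  | nil => rfl
  | cons a l ih =>
    simp only [coboundary, List.map_cons]
    rw [ih fun m => φ (f a :: m)]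

lemma coboundary_congr {φ ψ : List α → ZMod 2} {l : List α}
    (h : ∀ m, m.Sublist l → m.length + 1 = l.length → φ m = ψ m) :
    coboundary φ l = coboundary ψ l := by
  induction l generalizing φ ψ with
  | nil => rfl
  | cons a l ih =>
    simp only [coboundary]
    rw [h l (List.sublist_cons_self a l) rfl]
    congr 1
    exact ih fun m hm hl => h _ (hm.cons_cons a) (by simp [hl])

lemma coboundary_filter (p : α → Bool) (G : List α → List α → ZMod 2) (l : List α) :
    coboundary (fun m => G (m.filter fun x => !p x) (m.filter p)) l =
      coboundary (fun m => G m (l.filter p)) (l.filter fun x => !p x) +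
        coboundary (fun m => G (l.filter fun x => !p x) m) (l.filter p) := by
  induction l generalizing G with
  | nil => simp [coboundary]
  | cons a l ih =>
    cases h : p a
    · have := ih fun A B => G (a :: A) B
      simp only [coboundary, List.filter_cons, h]
      simp [coboundary, this, add_assoc]
    · have := ih fun A B => G A (a :: B)
      simp only [coboundary, List.filter_cons, h]
      simp [coboundary, this]
      ring

end Coboundary

section Subdivision

variable {α : Type*} (b : List α → α)

lemma subdiv_add (n : ℕ) (φ ψ : List α → ZMod 2) (l : List α) :
    subdiv b n (fun m => φ m + ψ m) l = subdiv b n φ l + subdiv b n ψ l := by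
  induction n generalizing φ ψ l with
  | zero => rfl
  | succ n ih =>
    simp only [subdiv]
    rw [← coboundary_add]
    congr 1
    funext m
    exact ih _ _ _

lemma subdiv_coboundary (n : ℕ) (φ : List α → ZMod 2) (l : List α) :
    subdiv b (n + 1) (coboundary φ) l = coboundary (subdiv b n φ) l := by
  induction n generalizing φ l with
  | zero =>
    simp only [subdiv, coboundary]
    rw [coboundary_add, coboundary_coboundary, add_zero]
  | succ n ih =>
    rw [subdiv]
    have : (subdiv b (n + 1) fun m => coboundary φ (b l :: m)) = fun m =>
        subdiv b (n + 1) φ m + coboundary (subdiv b n fun m => φ (b l :: m)) m := by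
      funext m
      rw [← ih, ← subdiv_add]
      rfl
    rw [this, coboundary_add, coboundary_coboundary, add_zero]

lemma subdiv_map (f : α → α) (hb : ∀ l, b (l.map f) = f (b l)) (n : ℕ)
    (φ : List α → ZMod 2) (l : List α) :
    subdiv b n (fun m => φ (m.map f)) l = subdiv b n φ (l.map f) := by
  induction n generalizing φ l with
  | zero => rfl
  | succ n ih =>
    simp only [subdiv, ← coboundary_map, List.map_cons, hb]
    congr 1
    funext m
    exact ih (fun m => φ (f (b l) :: m)) m

lemma subdiv_iterate_add (n k : ℕ) (φ ψ : List α → ZMod 2) :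
    (subdiv b n)^[k] (fun m => φ m + ψ m) =
      fun m => (subdiv b n)^[k] φ m + (subdiv b n)^[k] ψ m := by
  induction k generalizing φ ψ with
  | zero => rfl
  | succ k ih =>
    simp only [Function.iterate_succ_apply', ih]
    funext l
    exact subdiv_add b n _ _ l

lemma subdiv_iterate_coboundary (n k : ℕ) (φ : List α → ZMod 2) :
    (subdiv b (n + 1))^[k] (coboundary φ) = coboundary ((subdiv b n)^[k] φ) := by
  induction k generalizing φ with
  | zero => rfl
  | succ k ih =>
    simp only [Function.iterate_succ_apply', ih]
    funext l
    exact subdiv_coboundary b n _ l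

lemma subdiv_iterate_map (f : α → α) (hb : ∀ l, b (l.map f) = f (b l)) (n k : ℕ)
    (φ : List α → ZMod 2) :
    (subdiv b n)^[k] (fun m => φ (m.map f)) = fun m => (subdiv b n)^[k] φ (m.map f) := by
  induction k generalizing φ with
  | zero => rfl
  | succ k ih =>
    simp only [Function.iterate_succ_apply', ih]
    funext l
    exact subdiv_map b f hb n _ l

end Subdivision

section CrossSum

variable {α : Type*} [InvolutiveNeg α] (e : ℕ → α)

lemma crossSum_add (n : ℕ) (φ ψ : List α → ZMod 2) :
    crossSum e n (fun m => φ m + ψ m) = crossSum e n φ + crossSum e n ψ := by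
  induction n generalizing φ ψ with
  | zero => rfl
  | succ n ih => simp only [crossSum, ih]; ring

lemma crossSum_neg (n : ℕ) (φ : List α → ZMod 2) :
    crossSum e n (fun m => φ (m.map Neg.neg)) = crossSum e n φ := by
  induction n generalizing φ with
  | zero => rfl
  | succ n ih =>
    simp only [crossSum, List.map_cons, neg_neg]
    rw [ih fun m => φ (-e n :: m), ih fun m => φ (e n :: m), add_comm]

lemma crossSum_coboundary (n : ℕ) (φ : List α → ZMod 2) :
    crossSum e n (coboundary φ) = 0 := by
  induction n generalizing φ with
  | zero => rfl
  | succ n ih =>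
    simp only [crossSum, coboundary, crossSum_add]
    rw [ih fun m => φ (e n :: m), ih fun m => φ (-e n :: m)]
    simpa using CharTwo.add_self_eq_zero _

lemma crossSum_congr {n : ℕ} {φ ψ : List α → ZMod 2}
    (h : ∀ l : List α, l.length = n →
      (∃ s : ℕ → Bool, ∀ x ∈ l, ∃ i < n, x = if s i then e i else -e i) → φ l = ψ l) :
    crossSum e n φ = crossSum e n ψ := by
  induction n generalizing φ ψ with
  | zero => exact h [] rfl (by simp)
  | succ n ih =>
    have key (t : Bool) (l : List α) (hl : l.length = n)
        (hs : ∃ s : ℕ → Bool, ∀ x ∈ l, ∃ i < n, x = if s i then e i else -e i) :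
        φ ((if t then e n else -e n) :: l) = ψ ((if t then e n else -e n) :: l) := by
      obtain ⟨s, hs⟩ := hs
      refine h _ (by simp [hl]) ⟨Function.update s n t, ?_⟩
      intro x hx
      rcases List.mem_cons.1 hx with rfl | hx
      · exact ⟨n, n.lt_succ_self, by simp⟩
      · obtain ⟨i, hi, rfl⟩ := hs x hx
        exact ⟨i, hi.trans n.lt_succ_self, by simp [Function.update_of_ne hi.ne]⟩
    simp only [crossSum]
    congr 1
    · exact ih fun l hl hs => by simpa using key true l hl hs
    · exact ih fun l hl hs => by simpa using key false l hl hs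

/-- If the coboundary of `ψ` is `ψ + ν ψ`, where `ν` is the antipodal action, then consecutive
evaluations on cross-polytopes agree. The hypothesis is only required on the half of the
cross-polytope containing the last vertex. -/
lemma crossSum_succ_eq {n : ℕ} {ψ ψ' : List α → ZMod 2}
    (h : crossSum e n (fun m => ψ (e n :: m) + ψ ((e n :: m).map Neg.neg)) =
      crossSum e n (fun m => coboundary ψ' (e n :: m))) :
    crossSum e (n + 1) ψ = crossSum e n ψ' := by
  have h1 : crossSum e n (fun m => ψ (-e n :: m)) =
      crossSum e n (fun m => ψ ((e n :: m).map Neg.neg)) := by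
    rw [← crossSum_neg e n fun m => ψ (-e n :: m)]
    rfl
  rw [crossSum, h1, ← crossSum_add, h]
  simp only [coboundary, crossSum_add]
  rw [crossSum_coboundary e n fun m => ψ' (e n :: m), add_zero]

end CrossSum

section Fan

/-- The antipode of a signed label. -/
def flip (x : ℕ × Bool) : ℕ × Bool := (x.1, !x.2)

/-- One step in the definition of `fan`: `B` lists the labels of top index and `A` the others. -/
def fanStep (φ : List (ℕ × Bool) → ZMod 2) (A : List (ℕ × Bool)) :
    List (ℕ × Bool) → ZMod 2
  | [] => φ A
  | [x] => if x.2 then φ (A.map flip) else 0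
  | _ :: _ :: _ => 0

/-- The indicator modulo two of lists of signed labels whose indices are distinct and less
than `d`, and whose signs alternate and start with `true` when ordered by decreasing index. -/
def fan : ℕ → List (ℕ × Bool) → ZMod 2
  | 0, L => if L = [] then 1 else 0
  | d + 1, L => fanStep (fan d) (L.filter fun x => !decide (x.1 = d))
      (L.filter fun x => decide (x.1 = d))

lemma fan_nil (d : ℕ) : fan d [] = 1 := by
  induction d with
  | zero => rfl
  | succ d ih => simpa [fan, fanStep] using ih

lemma fan_eq_zero {d : ℕ} {L : List (ℕ × Bool)} (h : d < L.length) : fan d L = 0 := by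
  induction d generalizing L with
  | zero => simp [fan, List.ne_nil_of_length_pos h]
  | succ d ih =>
    have hlen := List.length_eq_length_filter_add (l := L) fun x => decide (x.1 = d)
    rw [fan]
    rcases hB : L.filter fun x => decide (x.1 = d) with _ | ⟨x, _ | ⟨y, B⟩⟩
    · rw [hB] at hlen ⊢
      exact ih (by simp only [List.length_nil] at hlen; omega)
    · rw [hB] at hlen
      have := ih (L := (L.filter fun x => !decide (x.1 = d)).map flip)
        (by simp only [List.length_cons, List.length_nil, List.length_map] at hlen ⊢; omega)
      simp only [hB, fanStep, this, ite_self]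
    · rw [hB]
      rfl

lemma flip_snd (x : ℕ × Bool) : (flip x).2 = !x.2 := rfl

lemma flip_flip (x : ℕ × Bool) : flip (flip x) = x := by simp [flip]

lemma map_flip_filter (p : ℕ → Bool) (L : List (ℕ × Bool)) :
    (L.map flip).filter (fun x => p x.1) = (L.filter fun x => p x.1).map flip := by
  rw [List.filter_map]
  rfl

/-- The combinatorial core of Ky Fan's lemma. -/
lemma coboundary_fan {d : ℕ} {L : List (ℕ × Bool)} (hd : ∀ x ∈ L, x.1 < d)
    (hL : ∀ x ∈ L, ∀ y ∈ L, x.1 = y.1 → x.2 = y.2) :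
    coboundary (fan d) L = fan d L + fan d (L.map flip) := by
  induction d generalizing L with
  | zero =>
    obtain rfl : L = [] := List.eq_nil_iff_forall_not_mem.2 fun x hx => by simpa using hd x hx
    simp only [coboundary, List.map_nil]
    exact (CharTwo.add_self_eq_zero _).symm
  | succ d ih =>
    have h1 := coboundary_filter (fun x : ℕ × Bool => decide (x.1 = d)) (fanStep (fan d)) L
    have h2 := map_flip_filter (fun i => decide (i = d)) L
    have h3 := map_flip_filter (fun i => !decide (i = d)) L
    change coboundary (fan (d + 1)) L = _ at h1
    rw [h1]
    simp only [fan]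
    rw [h2, h3]
    have hA' : (∀ x ∈ L.filter fun x => !decide (x.1 = d), x.1 < d) ∧
        ∀ x ∈ L.filter fun x => !decide (x.1 = d),
          ∀ y ∈ L.filter fun x => !decide (x.1 = d), x.1 = y.1 → x.2 = y.2 := by
      refine ⟨fun x hx => ?_, fun x hx y hy =>
        hL x (List.mem_filter.1 hx).1 y (List.mem_filter.1 hy).1⟩
      have h1 := hd x (List.mem_filter.1 hx).1
      have h2 := (List.mem_filter.1 hx).2
      simp only [Bool.not_eq_eq_eq_not, Bool.not_true, decide_eq_false_iff_not] at h2
      omega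
    have hA := ih hA'.1 hA'.2
    have hB : ∀ x ∈ L.filter fun x => decide (x.1 = d),
        ∀ y ∈ L.filter fun x => decide (x.1 = d), x = y := by
      intro x hx y hy
      simp only [List.mem_filter, decide_eq_true_eq] at hx hy
      exact Prod.ext (hx.2.trans hy.2.symm) (hL x hx.1 y hy.1 (hx.2.trans hy.2.symm))
    generalize (L.filter fun x => !decide (x.1 = d)) = A at *
    generalize (L.filter fun x => decide (x.1 = d)) = B at *
    have hflip : coboundary (fun m => fan d (m.map flip)) A = fan d (A.map flip) + fan d A := by
      rw [coboundary_map, ih, List.map_map, show flip ∘ flip = id from funext flip_flip,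
        List.map_id]
      · rw [List.forall_mem_map]
        exact hA'.1
      · simp only [List.forall_mem_map, flip_snd, Bool.not_inj_iff]
        exact hA'.2
    rcases B with _ | ⟨x, _ | ⟨y, B⟩⟩
    · simpa [fanStep, coboundary] using hA
    · have : A.map (flip ∘ flip) = A := by
        rw [show flip ∘ flip = id from funext flip_flip, List.map_id]
      cases hx : x.2
      · simp [fanStep, coboundary, coboundary_zero, hx, flip_snd, this]
      · simp only [fanStep, coboundary, hx, flip_snd, if_true, hflip, List.map_cons, List.map_nil]
        simp [add_assoc, CharTwo.add_self_eq_zero]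
    · obtain rfl : x = y := hB x (by simp) y (by simp)
      simp only [fanStep, coboundary, coboundary_zero, List.map_cons]
      rcases B with _ | ⟨z, B⟩
      · simp [CharTwo.add_self_eq_zero]
      · simp

end Fan

section Barycentric

variable {E : Type*} [NormedAddCommGroup E] [NormedSpace ℝ E]

/-- The barycenter of a list of points. -/
noncomputable def barycenter (l : List E) : E := (l.length : ℝ)⁻¹ • l.sum

lemma barycenter_map_neg (l : List E) : barycenter (l.map Neg.neg) = -barycenter l := by
  have h : (l.map Neg.neg).sum = -l.sum := by
    induction l with
    | nil => simp
    | cons a l ih =>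
      rw [List.map_cons, List.sum_cons, List.sum_cons, ih, neg_add]
  rw [barycenter, barycenter, h, List.length_map, smul_neg]

lemma barycenter_eq_sum (l : List E) :
    barycenter l = ∑ i : Fin l.length, (l.length : ℝ)⁻¹ • l[i] := by
  rw [barycenter, ← Finset.smul_sum]
  congr 1
  exact (Fin.sum_univ_getElem l).symm

lemma barycenter_mem_convexHull {l : List E} (hl : l ≠ []) :
    barycenter l ∈ convexHull ℝ {x | x ∈ l} := by
  rw [barycenter_eq_sum]
  have : (l.length : ℝ) ≠ 0 := by simpa using hl
  refine (convex_convexHull ℝ _).sum_mem (fun _ _ => by positivity) ?_ fun i _ =>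
    subset_convexHull ℝ _ (List.getElem_mem i.2)
  simp [this]

lemma dist_barycenter_le {l : List E} {r : ℝ} (h : ∀ x ∈ l, ∀ y ∈ l, dist x y ≤ r)
    {v : E} (hv : v ∈ l) :
    dist v (barycenter l) ≤ ((l.length : ℝ) - 1) / l.length * r := by
  obtain ⟨j, hj, rfl⟩ := List.mem_iff_getElem.1 hv
  have hpos : (0 : ℝ) < l.length := by exact_mod_cast Nat.zero_lt_of_lt hj
  have h1 : barycenter l - l[j] = (l.length : ℝ)⁻¹ • ∑ i : Fin l.length, (l[i] - l[j]) := by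
    rw [Finset.sum_sub_distrib, smul_sub, Finset.smul_sum, ← barycenter_eq_sum]
    simp only [Finset.sum_const, Finset.card_univ, Fintype.card_fin]
    rw [← Nat.cast_smul_eq_nsmul ℝ, smul_smul, inv_mul_cancel₀ hpos.ne', one_smul]
  have h2 : ‖∑ i : Fin l.length, (l[i] - l[j])‖ ≤ ((l.length : ℝ) - 1) * r := by
    calc ‖∑ i : Fin l.length, (l[i] - l[j])‖
        ≤ ∑ i : Fin l.length, (r - if i = ⟨j, hj⟩ then r else 0) := by
          refine norm_sum_le_of_le _ fun i _ => ?_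
          split_ifs with hi
          · subst hi
            simp
          · rw [← dist_eq_norm, sub_zero]
            exact h _ (List.getElem_mem i.2) _ hv
      _ = _ := by
          rw [Finset.sum_sub_distrib, Finset.sum_ite_eq' Finset.univ]
          simp
          ring
  rw [dist_comm, dist_eq_norm, h1, norm_smul, norm_inv, Real.norm_of_nonneg hpos.le,
    div_mul_eq_mul_div, inv_mul_eq_div]
  gcongr

lemma subdiv_congr {N n : ℕ} (hn : n ≤ N + 1) {r : ℝ} (hr : 0 ≤ r)
    {φ ψ : List E → ZMod 2} {l : List E} (hl : l.length = n)
    (hd : ∀ x ∈ l, ∀ y ∈ l, dist x y ≤ r)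
    (h : ∀ m : List E, m.length = n → (∀ x ∈ m, x ∈ convexHull ℝ {x | x ∈ l}) →
      (∀ x ∈ m, ∀ y ∈ m, dist x y ≤ N / (N + 1) * r) → φ m = ψ m) :
    subdiv barycenter n φ l = subdiv barycenter n ψ l := by
  induction n generalizing φ ψ l with
  | zero =>
    obtain rfl := List.length_eq_zero_iff.1 hl
    exact h [] rfl (by simp) (by simp)
  | succ n ih =>
    have hne : l ≠ [] := by rintro rfl; simp at hl
    refine coboundary_congr fun l' hl' hlen => ?_
    have hsub : convexHull ℝ {x | x ∈ l'} ⊆ convexHull ℝ {x | x ∈ l} :=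
      convexHull_mono fun x hx => hl'.subset hx
    refine ih (by omega) (by omega)
      (fun x hx y hy => hd x (hl'.subset hx) y (hl'.subset hy)) fun m hm hmem hdist => ?_
    have hb : ∀ x ∈ m, dist x (barycenter l) ≤ N / (N + 1) * r := by
      intro x hx
      have hball : convexHull ℝ {x | x ∈ l} ⊆
          Metric.closedBall (barycenter l) (N / (N + 1) * r) := by
        refine convexHull_min (fun v hv => ?_) (convex_closedBall _ _)
        refine (dist_barycenter_le hd hv).trans ?_
        refine mul_le_mul_of_nonneg_right ?_ hr
        rw [hl]
        have : (n : ℝ) ≤ N := by exact_mod_cast Nat.le_of_succ_le_succ hn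
        push_cast
        rw [div_le_div_iff₀ (by positivity) (by positivity)]
        nlinarith
      exact hball (hsub (hmem x hx))
    have h0 : 0 ≤ (N : ℝ) / (N + 1) * r := by positivity
    refine h _ (by simp [hm]) ?_ ?_
    · rintro x hx
      rcases List.mem_cons.1 hx with rfl | hx
      · exact barycenter_mem_convexHull hne
      · exact hsub (hmem x hx)
    · intro x hx y hy
      rcases List.mem_cons.1 hx with rfl | hx <;> rcases List.mem_cons.1 hy with rfl | hy
      · simpa using h0
      · rw [dist_comm]
        exact hb y hy
      · exact hb x hx
      · exact hdist x hx y hy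

lemma subdiv_iterate_congr {N n : ℕ} (hn : n ≤ N + 1) (k : ℕ) {r : ℝ} (hr : 0 ≤ r)
    {φ ψ : List E → ZMod 2} {l : List E} (hl : l.length = n)
    (hd : ∀ x ∈ l, ∀ y ∈ l, dist x y ≤ r)
    (h : ∀ m : List E, m.length = n → (∀ x ∈ m, x ∈ convexHull ℝ {x | x ∈ l}) →
      (∀ x ∈ m, ∀ y ∈ m, dist x y ≤ (N / (N + 1)) ^ k * r) → φ m = ψ m) :
    (subdiv barycenter n)^[k] φ l = (subdiv barycenter n)^[k] ψ l := by
  induction k generalizing r l with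
  | zero => exact h l hl (fun x hx => subset_convexHull ℝ _ hx) (by simpa using hd)
  | succ k ih =>
    simp only [Function.iterate_succ_apply']
    refine subdiv_congr hn hr hl hd fun m hm hmem hdist => ?_
    refine ih (by positivity) hm hdist fun m' hm' hmem' hdist' => ?_
    refine h m' hm' (fun x hx => ?_) fun x hx y hy => ?_
    · exact convexHull_min hmem (convex_convexHull ℝ _) (hmem' x hx)
    · rw [pow_succ, mul_assoc]
      exact hdist' x hx y hy

end Barycentric

section CrossPolytope

/-- The boundary of the cross-polytope, that is, the unit sphere of the `ℓ¹` norm. -/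
def crossSphere (ι : Type*) [Fintype ι] : Set (ι → ℝ) := {x | ∑ i, |x i| = 1}

lemma neg_mem_crossSphere {ι : Type*} [Fintype ι] {x : ι → ℝ} (hx : x ∈ crossSphere ι) :
    -x ∈ crossSphere ι := by
  simpa [crossSphere] using hx

lemma isCompact_crossSphere (ι : Type*) [Fintype ι] : IsCompact (crossSphere ι) := by
  refine Metric.isCompact_of_isClosed_isBounded ?_ ?_
  · exact isClosed_eq (by fun_prop) continuous_const
  · refine (Metric.isBounded_closedBall (x := (0 : ι → ℝ)) (r := 1)).subset fun x hx => ?_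
    rw [mem_closedBall_zero_iff, pi_norm_le_iff_of_nonneg zero_le_one]
    intro i
    rw [← show ∑ i, |x i| = 1 from hx]
    exact Finset.single_le_sum (f := fun i => |x i|) (fun _ _ => abs_nonneg _) (Finset.mem_univ i)

/-- The `n`-th coordinate vector of `Fin d → ℝ`. -/
def coordVec (d n : ℕ) : Fin d → ℝ := fun j => if (j : ℕ) = n then 1 else 0

lemma convexHull_subset_crossSphere {d : ℕ} {l : List (Fin d → ℝ)} {s : ℕ → Bool}
    (h : ∀ x ∈ l, ∃ i < d, x = if s i then coordVec d i else -coordVec d i) :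
    convexHull ℝ {x | x ∈ l} ⊆ crossSphere (Fin d) := by
  set σ : ℕ → ℝ := fun i => if s i then 1 else -1 with hσ
  have hsub : {x | x ∈ l} ⊆
      {x : Fin d → ℝ | (∀ i : Fin d, 0 ≤ σ i * x i) ∧ ∑ i : Fin d, σ i * x i = 1} := by
    intro x hx
    obtain ⟨i, hi, rfl⟩ := h x hx
    have key (j : Fin d) : σ j * (if s i then coordVec d i else -coordVec d i) j =
        if j = ⟨i, hi⟩ then 1 else 0 := by
      by_cases hj : (j : ℕ) = i
      · have hj' : j = ⟨i, hi⟩ := Fin.ext hj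
        subst hj'
        cases hs : s i <;> simp [σ, coordVec, hs]
      · have hj' : j ≠ ⟨i, hi⟩ := fun h => hj (congrArg Fin.val h)
        cases hs : s i <;> simp [coordVec, hj, hj']
    constructor
    · intro j
      rw [key]
      positivity
    · simp [key]
  have hconv : Convex ℝ
      {x : Fin d → ℝ | (∀ i : Fin d, 0 ≤ σ i * x i) ∧ ∑ i : Fin d, σ i * x i = 1} := by
    rintro x ⟨hx, hx'⟩ y ⟨hy, hy'⟩ a b ha hb hab
    have e (i : Fin d) : σ i * (a • x + b • y) i = a * (σ i * x i) + b * (σ i * y i) := by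
      simp only [Pi.add_apply, Pi.smul_apply, smul_eq_mul]
      ring
    constructor
    · intro i
      rw [e]
      have := hx i
      have := hy i
      positivity
    · simp only [e, Finset.sum_add_distrib, ← Finset.mul_sum, hx', hy']
      simpa using hab
  intro x hx
  obtain ⟨h1, h2⟩ := convexHull_min hsub hconv hx
  rw [crossSphere, Set.mem_ofPred_eq, ← h2]
  refine Finset.sum_congr rfl fun i _ => ?_
  rw [← abs_of_nonneg (h1 i), abs_mul]
  have : |σ i| = 1 := by
    simp only [hσ]
    split_ifs <;> simp
  rw [this, one_mul]

lemma norm_coordVec_le (d n : ℕ) : ‖coordVec d n‖ ≤ 1 := by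
  rw [pi_norm_le_iff_of_nonneg zero_le_one]
  intro i
  unfold coordVec
  split_ifs <;> simp

lemma dist_signed_coordVec_le {d i j : ℕ} (a b : Bool) :
    dist (if a then coordVec d i else -coordVec d i)
      (if b then coordVec d j else -coordVec d j) ≤ 2 := by
  have h (a : Bool) (i : ℕ) : ‖(if a then coordVec d i else -coordVec d i)‖ ≤ 1 := by
    cases a <;> simpa using norm_coordVec_le d i
  rw [dist_eq_norm]
  linarith [norm_sub_le (if a then coordVec d i else -coordVec d i)
    (if b then coordVec d j else -coordVec d j), h a i, h b j]

/-- There is no odd labelling of the `d`-dimensional cross-polytope sphere by `d` signed labels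
such that nearby points never carry opposite labels. -/
lemma exists_complementary {d : ℕ} {δ : ℝ} (hδ : 0 < δ) (lab : (Fin (d + 1) → ℝ) → ℕ × Bool)
    (hlt : ∀ x ∈ crossSphere (Fin (d + 1)), (lab x).1 < d)
    (hneg : ∀ x ∈ crossSphere (Fin (d + 1)), lab (-x) = flip (lab x)) :
    ∃ x ∈ crossSphere (Fin (d + 1)), ∃ y ∈ crossSphere (Fin (d + 1)), dist x y < δ ∧
      (lab x).1 = (lab y).1 ∧ (lab x).2 ≠ (lab y).2 := by
  by_contra! hcon
  obtain ⟨k, hk⟩ : ∃ k : ℕ, ((d : ℝ) / (d + 1)) ^ k * 2 < δ := by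
    obtain ⟨k, hk⟩ := exists_pow_lt_of_lt_one (half_pos hδ)
      (show (d : ℝ) / (d + 1) < 1 by rw [div_lt_one (by positivity)]; linarith)
    exact ⟨k, by linarith⟩
  set e := coordVec (d + 1)
  set ψ : List (Fin (d + 1) → ℝ) → ZMod 2 := fun l => fan d (l.map lab) with hψ
  set T : ℕ → (List (Fin (d + 1) → ℝ) → ZMod 2) → List (Fin (d + 1) → ℝ) → ZMod 2 :=
    fun n => (subdiv barycenter n)^[k] with hT
  have congr_T {n : ℕ} (hn : n ≤ d + 1) {φ φ' : List (Fin (d + 1) → ℝ) → ZMod 2}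
      {l : List (Fin (d + 1) → ℝ)} (hl : l.length = n)
      (hs : ∃ s : ℕ → Bool, ∀ x ∈ l, ∃ i < n, x = if s i then e i else -e i)
      (h : ∀ m : List (Fin (d + 1) → ℝ), m.length = n →
        (∀ x ∈ m, x ∈ crossSphere (Fin (d + 1))) → (∀ x ∈ m, ∀ y ∈ m, dist x y < δ) →
        φ m = φ' m) : T n φ l = T n φ' l := by
    obtain ⟨s, hs⟩ := hs
    refine subdiv_iterate_congr hn k zero_le_two hl ?_ fun m hm hmem hdist => ?_
    · intro x hx y hy
      obtain ⟨i, -, rfl⟩ := hs x hx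
      obtain ⟨j, -, rfl⟩ := hs y hy
      exact dist_signed_coordVec_le _ _
    · refine h m hm (fun x hx => ?_) fun x hx y hy => (hdist x hx y hy).trans_lt hk
      refine convexHull_subset_crossSphere (s := s) (fun x hx => ?_) (hmem x hx)
      obtain ⟨i, hi, rfl⟩ := hs x hx
      exact ⟨i, by omega, rfl⟩
  have hstep (n : ℕ) (hn : n ≤ d) :
      crossSum e (n + 1) (T (n + 1) ψ) = crossSum e n (T n ψ) := by
    refine crossSum_succ_eq e (crossSum_congr e fun l hl hs => ?_)
    have hs' : ∃ s : ℕ → Bool, ∀ x ∈ e n :: l, ∃ i < n + 1, x = if s i then e i else -e i := by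
      obtain ⟨s, hs⟩ := hs
      refine ⟨Function.update s n true, fun x hx => ?_⟩
      rcases List.mem_cons.1 hx with rfl | hx
      · exact ⟨n, n.lt_succ_self, by simp⟩
      · obtain ⟨i, hi, rfl⟩ := hs x hx
        exact ⟨i, hi.trans n.lt_succ_self, by simp [Function.update_of_ne hi.ne]⟩
    have h1 : T (n + 1) (fun m => ψ m + ψ (m.map Neg.neg)) (e n :: l) =
        T (n + 1) ψ (e n :: l) + T (n + 1) ψ ((e n :: l).map Neg.neg) := by
      rw [hT]
      dsimp only
      rw [subdiv_iterate_add, subdiv_iterate_map barycenter _ barycenter_map_neg]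
    have h2 : T (n + 1) (coboundary ψ) (e n :: l) = coboundary (T n ψ) (e n :: l) := by
      rw [hT]
      dsimp only
      rw [subdiv_iterate_coboundary]
    rw [← h1, ← h2]
    refine congr_T (by omega) (by simp [hl]) hs' fun m _ hmem hdist => ?_
    rw [hψ, coboundary_map, coboundary_fan]
    · dsimp only
      rw [List.map_map, List.map_map]
      congr 2
      exact List.map_congr_left fun x hx => hneg x (hmem x hx)
    · rw [List.forall_mem_map]
      exact fun x hx => hlt x (hmem x hx)
    · simp only [List.forall_mem_map]
      exact fun x hx y hy => hcon x (hmem x hx) y (hmem y hy) (hdist x hx y hy)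
  have hone (n : ℕ) (hn : n ≤ d + 1) : crossSum e n (T n ψ) = 1 := by
    induction n with
    | zero =>
      have : T 0 ψ = ψ := Function.iterate_fixed rfl k
      rw [this]
      exact fan_nil d
    | succ n ih => rw [hstep n (by omega), ih (by omega)]
  have hzero : crossSum e (d + 1) (T (d + 1) ψ) = crossSum e (d + 1) fun _ => 0 := by
    refine crossSum_congr e fun l hl hs => ?_
    rw [congr_T le_rfl hl hs (φ' := fun _ => 0) fun m hm _ _ => fan_eq_zero (by simp [hm])]
    have := congrFun (subdiv_iterate_add barycenter (d + 1) k (fun _ => 0) fun _ => 0) l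
    simpa using this
  have h0 : crossSum e (d + 1) (fun _ => 0) = 0 := by
    simpa using crossSum_add e (d + 1) (fun _ => 0) fun _ => 0
  exact one_ne_zero ((hone _ le_rfl).symm.trans (hzero.trans h0))

/-- The **Borsuk–Ulam theorem**, for the sphere of the `ℓ¹` norm. -/
theorem exists_eq_zero_of_odd {d : ℕ} (g : (Fin (d + 1) → ℝ) → Fin d → ℝ)
    (hg : ContinuousOn g (crossSphere (Fin (d + 1))))
    (hodd : ∀ x ∈ crossSphere (Fin (d + 1)), g (-x) = -g x) :
    ∃ x ∈ crossSphere (Fin (d + 1)), g x = 0 := by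
  by_contra! hcon
  have hK := isCompact_crossSphere (Fin (d + 1))
  have hne : (crossSphere (Fin (d + 1))).Nonempty :=
    ⟨Pi.single 0 1, by simp [crossSphere, Pi.single_apply, apply_ite abs]⟩
  obtain ⟨x₀, hx₀, hmin⟩ := hK.exists_isMinOn hne hg.norm
  set ε := ‖g x₀‖ with hε
  have hεpos : 0 < ε := norm_pos_iff.2 (hcon x₀ hx₀)
  have hex : ∀ x ∈ crossSphere (Fin (d + 1)), ∃ i, ε ≤ |g x i| := by
    intro x hx
    by_contra! h
    exact ((pi_norm_lt_iff hεpos).2 h).not_ge (hmin hx)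
  have : Nonempty (Fin d) := ⟨(hex x₀ hx₀).choose⟩
  obtain ⟨δ, hδ, hunif⟩ := Metric.uniformContinuousOn_iff.1
    (hK.uniformContinuousOn_of_continuous hg) ε hεpos
  set idx : (Fin (d + 1) → ℝ) → Fin d := fun x => Classical.epsilon fun i => ε ≤ |g x i|
  have hidx : ∀ x ∈ crossSphere (Fin (d + 1)), ε ≤ |g x (idx x)| := fun x hx =>
    Classical.epsilon_spec (hex x hx)
  obtain ⟨x, hx, y, hy, hxy, h1, h2⟩ := exists_complementary hδ
    (fun x => ((idx x : ℕ), decide (0 < g x (idx x)))) (fun x _ => (idx x).2) (by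
      intro x hx
      have hi : idx (-x) = idx x := by simp [idx, hodd x hx]
      have := abs_pos.1 (hεpos.trans_le (hidx x hx))
      ext1
      · exact congrArg Fin.val hi
      · simp only [flip, hi, hodd x hx, Pi.neg_apply, Left.neg_pos_iff, ← decide_not, not_lt]
        exact decide_eq_decide.2 (by rw [le_iff_lt_or_eq]; tauto))
  have hi : idx x = idx y := Fin.ext h1
  have hd := (dist_le_pi_dist (g x) (g y) (idx y)).trans_lt (hunif x hx y hy hxy)
  have hx' := hidx x hx
  have hy' := hidx y hy
  simp only [hi] at h2 hx'
  rw [Real.dist_eq, abs_lt] at hd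
  apply h2
  rw [decide_eq_decide]
  rcases le_abs.1 hx' with h | h <;> rcases le_abs.1 hy' with h' | h' <;>
    constructor <;> intro <;> linarith

end CrossPolytope

section Radon

/-- The **topological Radon theorem**: a continuous map from the `(d + 1)`-simplex to `ℝ^d`
identifies two points with disjoint supports. -/
theorem exists_disjoint_support_eq {d : ℕ} (F : (Fin (d + 2) → ℝ) → Fin d → ℝ)
    (hF : ContinuousOn F (stdSimplex ℝ (Fin (d + 2)))) :
    ∃ p ∈ stdSimplex ℝ (Fin (d + 2)), ∃ q ∈ stdSimplex ℝ (Fin (d + 2)),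
      (∀ i, p i = 0 ∨ q i = 0) ∧ F p = F q := by
  set u : (Fin (d + 1) → ℝ) → Fin (d + 2) → ℝ := fun x => Fin.cons (-∑ i, x i) x
  have hu_neg (x) : u (-x) = -u x := by
    funext i
    refine Fin.cases ?_ (fun i => ?_) i <;> simp [u]
  have hu_sum (x) : ∑ i, u x i = 0 := by simp [u, Fin.sum_univ_succ]
  have hu_cont : Continuous u := by
    refine continuous_pi fun i => ?_
    refine Fin.cases ?_ (fun i => ?_) i
    · simp only [u, Fin.cons_zero]
      fun_prop
    · simp only [u, Fin.cons_succ]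
      fun_prop
  have hpos : ∀ x ∈ crossSphere (Fin (d + 1)), 0 < ∑ i, max (u x i) 0 := by
    intro x hx
    refine (Finset.sum_nonneg fun _ _ => le_max_right _ _).lt_of_ne' fun h0 => ?_
    have h1 : ∀ i, u x i ≤ 0 := fun i => max_eq_right_iff.1
      ((Finset.sum_eq_zero_iff_of_nonneg fun _ _ => le_max_right _ _).1 h0 i (Finset.mem_univ i))
    have h2 : ∀ i, u x i = 0 := fun i =>
      (Finset.sum_eq_zero_iff_of_nonpos fun i _ => h1 i).1 (hu_sum x) i (Finset.mem_univ i)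
    have h3 : ∀ i, x i = 0 := fun i => by simpa [u] using h2 i.succ
    have h4 : ∑ i, |x i| = 1 := hx
    simp [h3] at h4
  set P : (Fin (d + 1) → ℝ) → Fin (d + 2) → ℝ :=
    fun x i => max (u x i) 0 / ∑ j, max (u x j) 0
  have hP_mem : ∀ x ∈ crossSphere (Fin (d + 1)), P x ∈ stdSimplex ℝ (Fin (d + 2)) := by
    intro x hx
    refine ⟨fun i => div_nonneg (le_max_right _ _) (hpos x hx).le, ?_⟩
    simp only [P]
    rw [← Finset.sum_div, div_self (hpos x hx).ne']
  have hP_cont : ContinuousOn P (crossSphere (Fin (d + 1))) := by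
    refine continuousOn_pi.2 fun i => ContinuousOn.div ?_ ?_ fun x hx => (hpos x hx).ne'
    · fun_prop
    · fun_prop
  have hneg : Set.MapsTo (fun x : Fin (d + 1) → ℝ => -x) (crossSphere (Fin (d + 1)))
      (crossSphere (Fin (d + 1))) := fun x hx => neg_mem_crossSphere hx
  obtain ⟨x, hx, h⟩ := exists_eq_zero_of_odd (fun x => F (P x) - F (P (-x)))
    ((hF.comp hP_cont hP_mem).sub
      (hF.comp (hP_cont.comp continuous_neg.continuousOn hneg) fun x hx => hP_mem _ (hneg hx)))
    (fun x _ => by simp)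
  refine ⟨P x, hP_mem x hx, P (-x), hP_mem _ (hneg hx), fun i => ?_, sub_eq_zero.1 h⟩
  simp only [P, hu_neg, Pi.neg_apply]
  rcases le_total (u x i) 0 with h | h
  · left
    simp [h]
  · right
    rw [max_eq_right (neg_nonpos.2 h), zero_div]

end Radon

section Skeleton

/-- Adding the nonnegative products over all `n`-subsets detects points with fewer than `n`
nonzero coordinates. -/
lemma sum_prod_powersetCard_eq_zero_iff {ι : Type*} [Fintype ι] [DecidableEq ι] {x : ι → ℝ}
    (hx : ∀ i, 0 ≤ x i) (n : ℕ) :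
    ∑ s ∈ Finset.univ.powersetCard n, ∏ i ∈ s, x i = 0 ↔
      (Finset.univ.filter fun i => x i ≠ 0).card < n := by
  rw [Finset.sum_eq_zero_iff_of_nonneg fun s _ => Finset.prod_nonneg fun i _ => hx i]
  constructor
  · intro h
    by_contra! hn
    obtain ⟨s, hs, hcard⟩ := Finset.exists_subset_card_eq hn
    have := h s (Finset.mem_powersetCard.2 ⟨Finset.subset_univ s, hcard⟩)
    obtain ⟨i, hi, h0⟩ := Finset.prod_eq_zero_iff.1 this
    exact (Finset.mem_filter.1 (hs hi)).2 h0
  · intro h s hs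
    have hcard := (Finset.mem_powersetCard.1 hs).2
    obtain ⟨i, hi, hi'⟩ := Finset.exists_mem_notMem_of_card_lt_card (hcard ▸ h)
    exact Finset.prod_eq_zero hi (by simpa using hi')

end Skeleton

end BorsukUlam

/-- Van Kampen–Flores theorem: for any continuous map from the `(2k+2)`-simplex to
`ℝ^{2k}` there are two disjoint `k`-dimensional faces whose images intersect. -/
theorem stmt_13 (k : ℕ) (hk : 0 < k)
    (f : (Fin (2 * k + 3) → ℝ) → EuclideanSpace ℝ (Fin (2 * k)))
    (hf : ContinuousOn f (stdSimplex ℝ (Fin (2 * k + 3)))) :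
    ∃ A B : Finset (Fin (2 * k + 3)), Disjoint A B ∧ A.card = k + 1 ∧ B.card = k + 1 ∧
      (f '' {x ∈ stdSimplex ℝ (Fin (2 * k + 3)) | ∀ i ∉ A, x i = 0} ∩
        f '' {x ∈ stdSimplex ℝ (Fin (2 * k + 3)) | ∀ i ∉ B, x i = 0}).Nonempty := by
  set h : (Fin (2 * k + 3) → ℝ) → ℝ := fun x =>
    ∑ s ∈ Finset.univ.powersetCard (k + 2), ∏ i ∈ s, x i
  obtain ⟨p, hp, q, hq, hpq, hF⟩ := BorsukUlam.exists_disjoint_support_eq (d := 2 * k + 1)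
    (fun x => Fin.cons (h x) (f x).ofLp) (by
      refine continuousOn_pi.2 fun i => ?_
      refine Fin.cases ?_ (fun i => ?_) i
      · simp only [Fin.cons_zero, h]
        fun_prop
      · simp only [Fin.cons_succ]
        fun_prop)
  have hheq : h p = h q := by simpa using congrFun hF 0
  have hfeq : f p = f q := by
    ext i
    simpa using congrFun hF i.succ
  set S := Finset.univ.filter fun i => p i ≠ 0
  set R := Finset.univ.filter fun i => q i ≠ 0
  have hdisj : Disjoint S R := by
    rw [Finset.disjoint_left]
    intro i hi hi'
    exact (hpq i).elim (Finset.mem_filter.1 hi).2 (Finset.mem_filter.1 hi').2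
  have hcard : S.card + R.card ≤ 2 * k + 3 := by
    rw [← Finset.card_union_of_disjoint hdisj]
    simpa using Finset.card_le_univ (S ∪ R)
  have hSp := BorsukUlam.sum_prod_powersetCard_eq_zero_iff hp.1 (k + 2)
  have hRq := BorsukUlam.sum_prod_powersetCard_eq_zero_iff hq.1 (k + 2)
  have hiff : S.card < k + 2 ↔ R.card < k + 2 := by
    rw [← hSp, ← hRq]
    exact ⟨fun h0 => hheq.symm.trans h0, fun h0 => hheq.trans h0⟩
  have hSk : S.card ≤ k + 1 := by omega
  have hRk : R.card ≤ k + 1 := by omega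
  obtain ⟨A, hSA, hAR, hA⟩ := Finset.exists_subsuperset_card_eq
    (Finset.subset_compl_iff_disjoint_right.2 hdisj) hSk
    (by rw [Finset.card_compl, Fintype.card_fin]; omega)
  obtain ⟨B, hRB, hBA, hB⟩ := Finset.exists_subsuperset_card_eq
    (Finset.subset_compl_comm.1 hAR) hRk
    (by rw [Finset.card_compl, Fintype.card_fin]; omega)
  have hzero {x : Fin (2 * k + 3) → ℝ} {D : Finset (Fin (2 * k + 3))}
      (hD : Finset.univ.filter (fun i => x i ≠ 0) ⊆ D) : ∀ i ∉ D, x i = 0 := by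
    intro i hi
    by_contra h0
    exact hi (hD (by simpa using h0))
  exact ⟨A, B, (Finset.subset_compl_iff_disjoint_left.1 hBA), hA, hB, f p,
    ⟨p, ⟨hp, hzero hSA⟩, rfl⟩, ⟨q, ⟨hq, hzero hRB⟩, hfeq.symm⟩⟩
end

section
/- (Topological Tverberg theorem in the plane, for prime powers.) Let r be a prime power (r = q^m for a prime q and integer m ≥ 1) and let f be a continuous map from the standard simplex Δ_{3r−3} = stdSimplex ℝ (Fin (3r−2)) to the plane ℝ². Then there exist r pairwise disjoint nonempty subsets A₁, …, A_r ⊆ Fin (3r−2) such that the images under f of the faces spanned by A₁, …, A_r have a common point: the intersection over s of f '' {x ∈ Δ_{3r−3} : ∀ i ∉ A_s, x i = 0} is nonempty. -/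
namespace PlanarTverberg

open Finsupp

section Chains

variable {S : Type*}

/-- The chain `c` joined with the vertex `x`. -/
noncomputable def cone (x : S) : (List S →₀ ℤ) →ₗ[ℤ] (List S →₀ ℤ) :=
  Finsupp.lmapDomain ℤ ℤ (List.cons x)

/-- The boundary of an ordered simplex, in the complex augmented by the empty simplex. -/
noncomputable def listBdry : List S → (List S →₀ ℤ)
  | [] => 0
  | x :: l => single l 1 - cone x (listBdry l)

/-- The boundary operator of the augmented complex of ordered chains on `S`. -/
noncomputable def bdry : (List S →₀ ℤ) →ₗ[ℤ] (List S →₀ ℤ) :=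
  Finsupp.linearCombination ℤ listBdry

@[simp] lemma cone_single (x : S) (l : List S) (n : ℤ) :
    cone x (single l n) = single (x :: l) n := by
  simp [cone]

@[simp] lemma bdry_single (l : List S) : bdry (single l 1) = listBdry l := by
  simp [bdry]

/-- Two linear maps on chains agree if they agree on simplices. -/
lemma linearMap_eq_of_single {B M : Type*} [AddCommGroup M] {f g : (B →₀ ℤ) →ₗ[ℤ] M}
    (h : ∀ b, f (single b 1) = g (single b 1)) (c : B →₀ ℤ) : f c = g c :=
  LinearMap.congr_fun (Finsupp.lhom_ext' fun b => LinearMap.ext_ring (h b)) c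

lemma bdry_cone (x : S) (c : List S →₀ ℤ) : bdry (cone x c) = c - cone x (bdry c) :=
  linearMap_eq_of_single (f := bdry ∘ₗ cone x) (g := LinearMap.id - cone x ∘ₗ bdry)
    (fun l => by simp [listBdry]) c

lemma bdry_bdry (c : List S →₀ ℤ) : bdry (bdry c) = 0 := by
  refine linearMap_eq_of_single (f := bdry ∘ₗ bdry) (g := 0) (fun l => ?_) c
  induction l with
  | nil => simp [listBdry]
  | cons x l ih =>
    simp only [LinearMap.comp_apply, bdry_single, listBdry, map_sub, bdry_cone,
      LinearMap.zero_apply] at ih ⊢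
    rw [ih]; simp

/-- Chains all of whose simplices have `n` vertices. -/
abbrev chainsOfLength (S : Type*) (n : ℕ) : Submodule ℤ (List S →₀ ℤ) :=
  Finsupp.supported ℤ ℤ {l | l.length = n}

lemma cone_mem {x : S} {n : ℕ} {c : List S →₀ ℤ} (hc : c ∈ chainsOfLength S n) :
    cone x c ∈ chainsOfLength S (n + 1) := by
  classical
  rw [Finsupp.mem_supported] at hc ⊢
  intro l hl
  obtain ⟨l', hl', rfl⟩ := Finset.mem_image.1 (Finsupp.mapDomain_support hl)
  simpa using hc hl'

lemma listBdry_mem (l : List S) : listBdry l ∈ chainsOfLength S (l.length - 1) := by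
  induction l with
  | nil => simp [listBdry]
  | cons x l ih =>
    refine Submodule.sub_mem _ (Finsupp.single_mem_supported ℤ 1 (by simp)) ?_
    rcases l with _ | ⟨y, l⟩
    · simp [listBdry]
    · simpa using cone_mem ih

/-- Every simplex of the boundary is a face. -/
lemma sublist_of_mem_listBdry {l l' : List S} (h : l' ∈ (listBdry l).support) :
    l'.Sublist l := by
  classical
  induction l generalizing l' with
  | nil => simp [listBdry] at h
  | cons x l ih =>
    rcases Finset.mem_union.1 (Finsupp.support_sub h) with h | h
    · have := Finsupp.support_single_subset h
      rw [Finset.mem_singleton] at this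
      subst this
      exact List.sublist_cons_self _ _
    · obtain ⟨l'', hl'', rfl⟩ := Finset.mem_image.1 (Finsupp.mapDomain_support h)
      exact (ih hl'').cons_cons x

lemma length_lt_of_mem_listBdry {l l' : List S} (h : l' ∈ (listBdry l).support) :
    l'.length < l.length := by
  rcases l with _ | ⟨x, l⟩
  · simp [listBdry] at h
  · have : l'.length = _ := (Finsupp.mem_supported _ _).1 (listBdry_mem (x :: l)) h
    simp [this]

/-- Linear maps may be defined recursively along a degree-lowering endomorphism. -/
lemma exists_recursive_linearMap {B M : Type*} [AddCommGroup M] (deg : B → ℕ)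
    (D : (B →₀ ℤ) →ₗ[ℤ] (B →₀ ℤ))
    (hD : ∀ b, ∀ b' ∈ (D (single b 1)).support, deg b' < deg b) (rule : B → M → M) :
    ∃ Φ : (B →₀ ℤ) →ₗ[ℤ] M, ∀ b, Φ (single b 1) = rule b (Φ (D (single b 1))) := by
  let F : (b : B) → ((b' : B) → deg b' < deg b → M) → M := fun b rec =>
    rule b (∑ b' ∈ (D (single b 1)).support.attach,
      D (single b 1) b'.1 • rec b'.1 (hD b b'.1 b'.2))
  have wf : WellFounded fun a b : B => deg a < deg b := (measure deg).wf
  refine ⟨Finsupp.linearCombination ℤ (wf.fix F), fun b => ?_⟩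
  rw [Finsupp.linearCombination_single, one_smul, wf.fix_eq]
  simp only [F]
  congr 1
  rw [Finsupp.linearCombination_apply, Finsupp.sum,
    ← Finset.sum_attach (D (single b 1)).support]

end Chains

section Action

variable {G S : Type*} [AddGroup G] [AddAction G S]

/-- The action of `G` on chains. -/
noncomputable def act (g : G) : (List S →₀ ℤ) →ₗ[ℤ] (List S →₀ ℤ) :=
  Finsupp.lmapDomain ℤ ℤ (List.map (g +ᵥ ·))

@[simp] lemma act_single (g : G) (l : List S) (n : ℤ) :
    act g (single l n) = single (l.map (g +ᵥ ·)) n := by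
  simp [act]

lemma act_cone (g : G) (x : S) (c : List S →₀ ℤ) :
    act g (cone x c) = cone (g +ᵥ x) (act g c) :=
  linearMap_eq_of_single (f := act g ∘ₗ cone x) (g := cone (g +ᵥ x) ∘ₗ act g)
    (fun l => by simp) c

lemma bdry_act (g : G) (c : List S →₀ ℤ) : bdry (act g c) = act g (bdry c) := by
  refine linearMap_eq_of_single (f := bdry ∘ₗ act g) (g := act g ∘ₗ bdry) (fun l => ?_) c
  induction l with
  | nil => simp [listBdry]
  | cons x l ih =>
    simp only [LinearMap.comp_apply, act_single, bdry_single, listBdry, map_sub, List.map_cons,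
      act_cone] at ih ⊢
    rw [ih]

end Action

section Resolution

variable {k p : ℕ}

/-- Basis elements of the tensor product of `k` periodic resolutions of `ℤ` over `ℤ[ℤ/p]`. -/
abbrev Cell (k p : ℕ) := (Fin k → ℕ) × (Fin k → ZMod p)

/-- Translation of cells by a group element. -/
noncomputable def shift (h : Fin k → ZMod p) : (Cell k p →₀ ℤ) →ₗ[ℤ] (Cell k p →₀ ℤ) :=
  Finsupp.lmapDomain ℤ ℤ fun b => (b.1, h + b.2)

@[simp] lemma shift_single (h : Fin k → ZMod p) (b : Cell k p) (n : ℤ) :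
    shift h (single b n) = single (b.1, h + b.2) n := by
  simp [shift]

lemma shift_shift (h h' : Fin k → ZMod p) (c : Cell k p →₀ ℤ) :
    shift h (shift h' c) = shift (h + h') c :=
  linearMap_eq_of_single (f := shift h ∘ₗ shift h') (g := shift (h + h'))
    (fun l => by simp [add_assoc]) c

lemma shift_comm (h h' : Fin k → ZMod p) : Commute (shift h) (shift h') :=
  LinearMap.ext fun c => by
    simp only [Module.End.mul_apply, shift_shift, add_comm]

/-- The degree of a cell. -/
def degree (b : Cell k p) : ℕ := ∑ i, b.1 i

/-- The span of the cells of degree `n`. -/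
abbrev cellsOfDegree (k p n : ℕ) : Submodule ℤ (Cell k p →₀ ℤ) :=
  Finsupp.supported ℤ ℤ {b | degree b = n}

lemma shift_mem {h : Fin k → ZMod p} {n : ℕ} {c : Cell k p →₀ ℤ} (hc : c ∈ cellsOfDegree k p n) :
    shift h c ∈ cellsOfDegree k p n := by
  classical
  rw [Finsupp.mem_supported] at hc ⊢
  intro l hl
  obtain ⟨l', hl', rfl⟩ := Finset.mem_image.1 (Finsupp.mapDomain_support hl)
  exact (hc hl' :)

lemma degree_update_pred {b : Cell k p} {i : Fin k} (h : b.1 i ≠ 0) :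
    degree ((Function.update b.1 i (b.1 i - 1), b.2) : Cell k p) + 1 = degree b := by
  unfold degree
  dsimp only
  rw [← Finset.add_sum_erase _ _ (Finset.mem_univ i), ← Finset.add_sum_erase _ b.1
    (Finset.mem_univ i), Function.update_self,
    Finset.sum_congr rfl fun l hl => Function.update_of_ne (Finset.ne_of_mem_erase hl) _ _]
  omega

variable [NeZero p]

/-- The coefficient of the differential of the periodic resolution of the `i`-th factor
in degree `n`, as an element of the group ring. -/
noncomputable def coeffOp (i : Fin k) (n : ℕ) : Module.End ℤ (Cell k p →₀ ℤ) :=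
  if n = 0 then 0 else if Odd n then shift (Pi.single i 1) - 1
  else ∑ t : ZMod p, shift (Pi.single i t)

lemma commute_shift_coeffOp (h : Fin k → ZMod p) (i : Fin k) (n : ℕ) :
    Commute (shift h) (coeffOp i n) := by
  unfold coeffOp
  split_ifs
  · exact Commute.zero_right _
  · exact (shift_comm _ _).sub_right (Commute.one_right _)
  · exact Commute.sum_right _ _ _ fun t _ => shift_comm _ _

lemma commute_coeffOp (i j : Fin k) (m n : ℕ) :
    Commute (coeffOp (p := p) i m) (coeffOp j n) := by
  rw [coeffOp]
  split_ifs
  · exact Commute.zero_left _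
  · exact (commute_shift_coeffOp _ _ _).sub_left (Commute.one_left _)
  · exact Commute.sum_left _ _ _ fun t _ => commute_shift_coeffOp _ _ _

lemma coeffOp_mul_self (i : Fin k) (n : ℕ) :
    coeffOp (p := p) i n * coeffOp i (n - 1) = 0 := by
  have key : (shift (Pi.single i 1) - 1 : Module.End ℤ (Cell k p →₀ ℤ)) *
      ∑ t : ZMod p, shift (Pi.single i t) = 0 := by
    rw [sub_mul, one_mul, Finset.mul_sum, sub_eq_zero]
    refine (Fintype.sum_equiv (Equiv.addLeft 1) _ _ fun t => ?_)
    refine LinearMap.ext fun c => ?_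
    rw [Module.End.mul_apply, shift_shift, Equiv.coe_addLeft, Pi.single_add]
  rcases n with _ | n
  · simp [coeffOp]
  rcases Nat.even_or_odd n with hn | hn
  · rcases n with _ | n
    · simp [coeffOp]
    · have h1 : Odd (n + 1 + 1) := hn.add_one
      have h2 : ¬ Odd (n + 1) := Nat.not_odd_iff_even.2 hn
      simpa [coeffOp, h1, h2] using key
  · have h1 : ¬ Odd (n + 1) := Nat.not_odd_iff_even.2 hn.add_one
    have h2 : n ≠ 0 := by rintro rfl; simp at hn
    rw [(commute_coeffOp _ _ _ _).eq]
    simpa [coeffOp, h1, hn, h2] using key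

/-- The Koszul sign in front of the `i`-th partial differential. -/
def koszulSign (i : Fin k) (I : Fin k → ℕ) : ℤ := (-1) ^ ∑ j ∈ Finset.univ.filter (· < i), I j

/-- The `i`-th partial differential. -/
noncomputable def partialDiff (i : Fin k) : Module.End ℤ (Cell k p →₀ ℤ) :=
  Finsupp.linearCombination ℤ fun b =>
    koszulSign i b.1 • coeffOp i (b.1 i) (single (Function.update b.1 i (b.1 i - 1), b.2) 1)

/-- The differential of the resolution. -/
noncomputable def diff : Module.End ℤ (Cell k p →₀ ℤ) := ∑ i, partialDiff i

lemma partialDiff_single (i : Fin k) (b : Cell k p) :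
    partialDiff i (single b 1) = koszulSign i b.1 •
      coeffOp i (b.1 i) (single (Function.update b.1 i (b.1 i - 1), b.2) 1) := by
  simp [partialDiff]

lemma commute_shift_partialDiff (h : Fin k → ZMod p) (i : Fin k) :
    Commute (shift h) (partialDiff i) := by
  refine LinearMap.ext fun c => linearMap_eq_of_single
    (f := shift h * partialDiff i) (g := partialDiff i * shift h) (fun b => ?_) c
  have := fun c => LinearMap.congr_fun (commute_shift_coeffOp (p := p) h i (b.1 i)).eq c
  simp only [Module.End.mul_apply] at this
  simp [partialDiff_single, this]

lemma commute_shift_diff (h : Fin k → ZMod p) : Commute (shift h) (diff (p := p)) :=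
  Commute.sum_right _ _ _ fun i _ => commute_shift_partialDiff h i

lemma commute_coeffOp_of_commute_shift {T : Module.End ℤ (Cell k p →₀ ℤ)}
    (hT : ∀ h, Commute (shift h) T) (i : Fin k) (n : ℕ) : Commute (coeffOp i n) T := by
  rw [coeffOp]
  split_ifs
  · exact Commute.zero_left _
  · exact (hT _).sub_left (Commute.one_left _)
  · exact Commute.sum_left _ _ _ fun t _ => hT _

lemma koszulSign_update_of_le {i j : Fin k} (h : i ≤ j) (I : Fin k → ℕ) (n : ℕ) :
    koszulSign i (Function.update I j n) = koszulSign i I := by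
  unfold koszulSign
  congr 1
  refine Finset.sum_congr rfl fun l hl => ?_
  rw [Function.update_of_ne]
  rintro rfl
  exact absurd (Finset.mem_filter.1 hl).2 h.not_gt

lemma koszulSign_update_pred {i j : Fin k} (h : j < i) (I : Fin k → ℕ) (hI : I j ≠ 0) :
    koszulSign i (Function.update I j (I j - 1)) = -koszulSign i I := by
  have hj : j ∈ Finset.univ.filter (· < i) := by simpa using h
  unfold koszulSign
  rw [← Finset.add_sum_erase _ _ hj, ← Finset.add_sum_erase _ _ hj, Function.update_self,
    Finset.sum_congr rfl fun l hl => Function.update_of_ne (Finset.ne_of_mem_erase hl) _ _]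
  obtain ⟨m, hm⟩ := Nat.exists_eq_succ_of_ne_zero hI
  rw [hm, Nat.succ_sub_one, Nat.succ_add, pow_succ]
  ring

lemma partialDiff_partialDiff_single (i j : Fin k) (b : Cell k p) :
    partialDiff i (partialDiff j (single b 1)) =
      (koszulSign j b.1 * koszulSign i (Function.update b.1 j (b.1 j - 1))) •
      (coeffOp j (b.1 j) * coeffOp i (Function.update b.1 j (b.1 j - 1) i) :
          Module.End ℤ (Cell k p →₀ ℤ))
        (single (Function.update (Function.update b.1 j (b.1 j - 1)) i
          (Function.update b.1 j (b.1 j - 1) i - 1), b.2) 1) := by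
  have := LinearMap.congr_fun (commute_coeffOp_of_commute_shift
    (fun h => commute_shift_partialDiff (p := p) h i) j (b.1 j)).eq
  simp only [Module.End.mul_apply] at this
  rw [partialDiff_single, map_smul, ← this, partialDiff_single, map_smul, smul_smul,
    Module.End.mul_apply]

lemma coeffOp_zero (i : Fin k) : coeffOp (p := p) i 0 = 0 := by simp [coeffOp]

lemma partialDiff_anticomm {i j : Fin k} (h : i < j) (b : Cell k p) :
    partialDiff i (partialDiff j (single b 1)) = -partialDiff j (partialDiff i (single b 1)) := by
  rw [partialDiff_partialDiff_single, partialDiff_partialDiff_single,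
    Function.update_of_ne h.ne, Function.update_of_ne h.ne', koszulSign_update_of_le h.le,
    (commute_coeffOp j i _ _).eq, Function.update_comm h.ne]
  rcases eq_or_ne (b.1 i) 0 with h0 | h0
  · simp [h0, coeffOp_zero]
  · rw [koszulSign_update_pred h _ h0]
    module

lemma partialDiff_self (i : Fin k) (b : Cell k p) :
    partialDiff i (partialDiff i (single b 1)) = 0 := by
  rw [partialDiff_partialDiff_single, Function.update_self, coeffOp_mul_self]
  simp

lemma diff_diff (c : Cell k p →₀ ℤ) : diff (diff c) = 0 := by
  refine linearMap_eq_of_single (f := diff * diff) (g := 0) (fun b => ?_) c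
  set T : Fin k → Fin k → (Cell k p →₀ ℤ) := fun i j => partialDiff i (partialDiff j (single b 1))
  have hT : ∀ i j, T i j = - T j i := by
    intro i j
    rcases lt_trichotomy i j with h | rfl | h
    · exact partialDiff_anticomm h b
    · simp [T, partialDiff_self]
    · simp only [T]; rw [partialDiff_anticomm h b, neg_neg]
  have h1 : (diff * diff : Module.End ℤ (Cell k p →₀ ℤ)) (single b 1) = ∑ i, ∑ j, T i j := by
    simp only [Module.End.mul_apply, diff, LinearMap.sum_apply, map_sum, T]
    exact Finset.sum_comm
  have h2 : ∑ i, ∑ j, T i j = -∑ i, ∑ j, T i j := by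
    conv_lhs => rw [Finset.sum_comm]
    simp_rw [← Finset.sum_neg_distrib]
    exact Finset.sum_congr rfl fun i _ => Finset.sum_congr rfl fun j _ => hT _ _
  rw [h1, LinearMap.zero_apply]
  exact self_eq_neg.1 h2

lemma coeffOp_mem {i : Fin k} {m n : ℕ} {c : Cell k p →₀ ℤ} (hc : c ∈ cellsOfDegree k p n) :
    coeffOp i m c ∈ cellsOfDegree k p n := by
  rw [coeffOp]
  split_ifs
  · exact Submodule.zero_mem _
  · exact Submodule.sub_mem _ (shift_mem hc) hc
  · rw [LinearMap.sum_apply]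
    exact Submodule.sum_mem _ fun t _ => shift_mem hc

lemma diff_mem {b : Cell k p} {n : ℕ} (hb : degree b = n + 1) :
    diff (single b 1) ∈ cellsOfDegree k p n := by
  rw [diff, LinearMap.sum_apply]
  refine Submodule.sum_mem _ fun i _ => ?_
  rw [partialDiff_single]
  rcases eq_or_ne (b.1 i) 0 with h0 | h0
  · simp [h0, coeffOp_zero]
  · refine Submodule.smul_mem _ _ (coeffOp_mem (Finsupp.single_mem_supported ℤ 1 ?_))
    have := degree_update_pred h0
    rw [Set.mem_ofPred_eq]
    omega

lemma diff_of_degree_zero {b : Cell k p} (hb : degree b = 0) : diff (single b 1) = 0 := by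
  rw [diff, LinearMap.sum_apply]
  refine Finset.sum_eq_zero fun i _ => ?_
  have : b.1 i = 0 := (Finset.sum_eq_zero_iff.1 hb) i (Finset.mem_univ i)
  rw [partialDiff_single, this, coeffOp_zero]
  simp

lemma degree_lt_of_mem_diff {b b' : Cell k p} (h : b' ∈ (diff (single b 1)).support) :
    degree b' < degree b := by
  rcases hb : degree b with _ | n
  · simp [diff_of_degree_zero hb] at h
  · have : degree b' = n := (Finsupp.mem_supported _ _).1 (diff_mem hb) h
    omega

/-- The augmentation of the resolution. -/
noncomputable def augment : (Cell k p →₀ ℤ) →ₗ[ℤ] ℤ :=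
  Finsupp.linearCombination ℤ fun b => if b.1 = 0 then 1 else 0

end Resolution

section Lower

variable {k p : ℕ}

/-- The operator lowering the exponent of the `i`-th factor by two. -/
noncomputable def lowerAt (i : Fin k) : Module.End ℤ (Cell k p →₀ ℤ) :=
  Finsupp.linearCombination ℤ fun b =>
    if 2 ≤ b.1 i then single (Function.update b.1 i (b.1 i - 2), b.2) 1 else 0

lemma lowerAt_single (i : Fin k) (b : Cell k p) :
    lowerAt i (single b 1) =
      if 2 ≤ b.1 i then single (Function.update b.1 i (b.1 i - 2), b.2) 1 else 0 := by
  simp [lowerAt]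

lemma commute_shift_lowerAt (h : Fin k → ZMod p) (i : Fin k) :
    Commute (shift h) (lowerAt i) := by
  refine LinearMap.ext fun c => linearMap_eq_of_single
    (f := shift h * lowerAt i) (g := lowerAt i * shift h) (fun b => ?_) c
  simp only [Module.End.mul_apply, lowerAt_single, shift_single]
  split_ifs <;> simp

/-- The operator lowering the degree by two that represents the Bockstein of the linear form `v`. -/
noncomputable def lower (v : Fin k → ZMod p) : Module.End ℤ (Cell k p →₀ ℤ) :=
  ∑ i, ((v i).val : ℤ) • lowerAt i

lemma commute_shift_lower (h v : Fin k → ZMod p) : Commute (shift h) (lower v) :=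
  Commute.sum_right _ _ _ fun i _ => (commute_shift_lowerAt h i).smul_right _

lemma koszulSign_update_sub_two (i j : Fin k) (I : Fin k → ℕ) (hI : 2 ≤ I j) :
    koszulSign i (Function.update I j (I j - 2)) = koszulSign i I := by
  rcases le_or_gt i j with h | h
  · exact koszulSign_update_of_le h I _
  have h1 := koszulSign_update_pred h I (by omega)
  have h2 := koszulSign_update_pred h (Function.update I j (I j - 1)) (by simp; omega)
  rw [h1, Function.update_self, Function.update_idem, neg_neg, Nat.sub_sub] at h2
  exact h2

lemma augment_single (b : Cell k p) : augment (single b 1) = if b.1 = 0 then 1 else 0 := by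
  simp [augment]

variable [NeZero p]

lemma coeffOp_sub_two {i : Fin k} {n : ℕ} (hn : 3 ≤ n) :
    coeffOp (p := p) i (n - 2) = coeffOp i n := by
  have h : Odd (n - 2) ↔ Odd n := by
    rw [Nat.odd_sub (by omega)]
    simp
  simp only [coeffOp, h, show n - 2 ≠ 0 by omega, show n ≠ 0 by omega, if_false]

lemma commute_lowerAt_partialDiff (i j : Fin k) :
    Commute (lowerAt (p := p) i) (partialDiff j) := by
  refine LinearMap.ext fun c => linearMap_eq_of_single
    (f := lowerAt i * partialDiff j) (g := partialDiff j * lowerAt i) (fun b => ?_) c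
  have hc := LinearMap.congr_fun (commute_coeffOp_of_commute_shift
    (fun h => commute_shift_lowerAt (p := p) h i) j (b.1 j)).eq
  simp only [Module.End.mul_apply] at hc ⊢
  rw [partialDiff_single, map_smul, ← hc, lowerAt_single, lowerAt_single]
  dsimp only
  rcases eq_or_ne i j with rfl | hij
  · simp only [Function.update_self]
    rcases lt_or_ge (b.1 i) 2 with h2 | h2
    · rw [if_neg (by omega), if_neg (by omega)]
      simp
    rw [if_pos h2, partialDiff_single, koszulSign_update_sub_two _ _ _ h2]
    simp only [Function.update_self, Function.update_idem]
    rcases h2.eq_or_lt with h3 | h3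
    · rw [if_neg (by omega), ← h3, Nat.sub_self, coeffOp_zero]
      simp
    · rw [if_pos (by omega), coeffOp_sub_two h3]
      rw [Nat.sub_sub, Nat.sub_sub]
  · simp only [ne_eq, hij, not_false_eq_true, Function.update_of_ne]
    split_ifs with h2
    · rw [partialDiff_single, koszulSign_update_sub_two _ _ _ h2]
      simp only [ne_eq, hij.symm, not_false_eq_true, Function.update_of_ne]
      rw [Function.update_comm hij]
    · simp

lemma lower_diff (v : Fin k → ZMod p) (c : Cell k p →₀ ℤ) : lower v (diff c) = diff (lower v c) := by
  have : Commute (lower (p := p) v) diff :=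
    Commute.sum_left _ _ _ fun i _ => Commute.smul_left
      (Commute.sum_right _ _ _ fun j _ => commute_lowerAt_partialDiff i j) _
  exact LinearMap.congr_fun this.eq c

lemma map_coeffOp_of_invariant {M : Type*} [AddCommGroup M] {φ : (Cell k p →₀ ℤ) →ₗ[ℤ] M}
    (hφ : ∀ h c, φ (shift h c) = φ c) (i : Fin k) (n : ℕ) (c : Cell k p →₀ ℤ) :
    φ (coeffOp i n c) = if n = 0 then 0 else if Odd n then 0 else p • φ c := by
  rw [coeffOp]
  split_ifs
  · simp
  · simp [hφ]
  · simp [hφ, LinearMap.sum_apply]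

/-- Invariant functionals annihilate, modulo `p`, the boundary of a cell with even exponents. -/
lemma dvd_map_diff_of_even {φ : (Cell k p →₀ ℤ) →ₗ[ℤ] ℤ}
    (hφ : ∀ h c, φ (shift h c) = φ c) {b : Cell k p} (hb : ∀ i, Even (b.1 i)) :
    (p : ℤ) ∣ φ (diff (single b 1)) := by
  rw [diff, LinearMap.sum_apply, map_sum]
  refine Finset.dvd_sum fun i _ => ?_
  rw [partialDiff_single, map_smul, map_coeffOp_of_invariant hφ,
    if_neg (Nat.not_odd_iff_even.2 (hb i))]
  refine Dvd.dvd.mul_left ?_ _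
  split_ifs
  · exact dvd_zero _
  · exact ⟨_, by rw [nsmul_eq_mul]⟩

/-- The functional `v` in degree one, normalised as an angle. -/
noncomputable def slope (v : Fin k → ZMod p) : (Cell k p →₀ ℤ) →ₗ[ℤ] ℝ :=
  Finsupp.linearCombination ℤ fun b =>
    ∑ i, if b.1 = Pi.single i 1 then 2 * Real.pi * (v i).val / p else 0

lemma slope_single (v : Fin k → ZMod p) (b : Cell k p) :
    slope v (single b 1) = ∑ i, if b.1 = Pi.single i 1 then 2 * Real.pi * (v i).val / p else 0 := by
  simp [slope]

lemma slope_shift (v h : Fin k → ZMod p) (c : Cell k p →₀ ℤ) : slope v (shift h c) = slope v c :=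
  linearMap_eq_of_single (f := slope v ∘ₗ shift h) (g := slope v)
    (fun b => by simp [slope_single]) c

lemma koszulSign_single (i : Fin k) (n : ℕ) : koszulSign i (Pi.single i n) = 1 := by
  unfold koszulSign
  rw [Finset.sum_eq_zero fun j hj => ?_, pow_zero]
  exact Pi.single_eq_of_ne (Finset.mem_filter.1 hj).2.ne _

lemma two_pi_mul_augment_lower (v : Fin k → ZMod p) (c : Cell k p →₀ ℤ) :
    2 * Real.pi * (augment (lower v c) : ℤ) = slope v (diff c) := by
  let f : (Cell k p →₀ ℤ) →ₗ[ℤ] ℝ :=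
    ((AddMonoidHom.mulLeft (2 * Real.pi)).comp (Int.castAddHom ℝ)).toIntLinearMap ∘ₗ
      augment ∘ₗ lower v
  refine linearMap_eq_of_single (f := f) (g := slope v ∘ₗ diff) (fun b => ?_) c
  change 2 * Real.pi * (augment (lower v (single b 1)) : ℤ) = slope v (diff (single b 1))
  simp only [lower, diff, LinearMap.sum_apply, map_sum, Int.cast_sum, Finset.mul_sum]
  refine Finset.sum_congr rfl fun j _ => ?_
  rw [partialDiff_single, map_smul, map_coeffOp_of_invariant (slope_shift v), LinearMap.smul_apply,
    map_smul, lowerAt_single]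
  rcases Nat.even_or_odd (b.1 j) with he | ho
  swap
  · rw [if_neg ho.pos.ne', if_pos ho]
    split_ifs with h2
    · rw [augment_single, if_neg]
      · simp
      · intro h
        have := congr_fun h j
        simp only [Function.update_self, Pi.zero_apply] at this
        obtain ⟨m, hm⟩ := ho
        omega
    · simp
  rcases eq_or_ne (b.1 j) 0 with h0 | h0
  · simp [h0]
  have h2 : 2 ≤ b.1 j := by obtain ⟨m, hm⟩ := he; omega
  rw [if_neg h0, if_neg (Nat.not_odd_iff_even.2 he), if_pos h2, slope_single, augment_single,
    Finset.sum_eq_single j]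
  · by_cases hb : b.1 = Pi.single j 2
    · have h1 : Function.update b.1 j (b.1 j - 2) = 0 := by rw [hb]; simp [Pi.single]
      have h3 : Function.update b.1 j (b.1 j - 1) = Pi.single j 1 := by
        rw [hb]; simp [Pi.single]
      have hp : (p : ℝ) ≠ 0 := Nat.cast_ne_zero.2 (NeZero.ne p)
      rw [if_pos h1, if_pos h3, hb, koszulSign_single]
      simp
      field_simp
    · rw [if_neg, if_neg]
      · simp
      · intro h
        refine hb (funext fun l => ?_)
        have := congr_fun h l
        rcases eq_or_ne l j with rfl | hl
        · simp at this ⊢; omega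
        · simpa [hl] using this
      · intro h
        refine hb (funext fun l => ?_)
        have := congr_fun h l
        rcases eq_or_ne l j with rfl | hl
        · simp at this ⊢; omega
        · simpa [hl] using this
  · intro i _ hi
    rw [if_neg]
    intro h
    have := congr_fun h j
    simp [hi.symm] at this
    obtain ⟨m, hm⟩ := he
    omega
  · simp

end Lower

section Cochains

variable {S : Type*} (F : S → ℂ)

/-- The angle from `F s` to `F t`. -/
noncomputable def turn (s t : S) : ℝ := (F t / F s).arg

/-- The winding number of `F` around the triangle `x`, `y`, `z`. -/
noncomputable def winding (x y z : S) : ℤ :=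
  round ((turn F x y + turn F y z - turn F x z) / (2 * Real.pi))

variable {F} in
lemma two_pi_mul_winding (hF : ∀ s, F s ≠ 0) (x y z : S) :
    2 * Real.pi * winding F x y z = turn F x y + turn F y z - turn F x z := by
  have h : ((turn F x y + turn F y z : ℝ) : Real.Angle) = (turn F x z : ℝ) := by
    simp only [turn, Real.Angle.coe_add, Complex.arg_div_coe_angle (hF _) (hF _)]
    abel
  obtain ⟨n, hn⟩ := Real.Angle.angle_eq_iff_two_pi_dvd_sub.1 h
  rw [winding, hn, mul_div_cancel_left₀ _ Real.two_pi_pos.ne', round_intCast]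

/-- Cap product of a simplex with the winding cocycle of `F`. -/
noncomputable def listCap : List S → (List S →₀ ℤ)
  | x :: y :: z :: l => single (z :: l) (winding F x y z)
  | _ => 0

/-- Cap product of a chain with the winding cocycle of `F`. -/
noncomputable def cap : (List S →₀ ℤ) →ₗ[ℤ] (List S →₀ ℤ) :=
  Finsupp.linearCombination ℤ (listCap F)

@[simp] lemma cap_single (l : List S) : cap F (single l 1) = listCap F l := by simp [cap]

/-- Sum of the turning angles over the edges of a chain. -/
noncomputable def turnSum : (List S →₀ ℤ) →ₗ[ℤ] ℝ :=
  Finsupp.linearCombination ℤ fun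
    | [x, y] => turn F x y
    | _ => 0

/-- Sum of the winding numbers over the triangles of a chain. -/
noncomputable def windingSum : (List S →₀ ℤ) →ₗ[ℤ] ℤ :=
  Finsupp.linearCombination ℤ fun
    | [x, y, z] => winding F x y z
    | _ => 0

/-- Sum of the arguments over the vertices of a chain. -/
noncomputable def angleSum : (List S →₀ ℤ) →ₗ[ℤ] Real.Angle :=
  Finsupp.linearCombination ℤ fun
    | [x] => ((F x).arg : Real.Angle)
    | _ => 0

/-- The coefficient of the empty simplex. -/
noncomputable def coeffNil : (List S →₀ ℤ) →ₗ[ℤ] ℤ := Finsupp.lapply []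

@[simp] lemma coeffNil_cone (x : S) (c : List S →₀ ℤ) : coeffNil (cone x c) = 0 :=
  linearMap_eq_of_single (f := coeffNil ∘ₗ cone x) (g := 0) (fun l => by simp [coeffNil]) c

variable {F}

lemma turnSum_cone_cone_cone (x y z : S) (c : List S →₀ ℤ) :
    turnSum F (cone x (cone y (cone z c))) = 0 :=
  linearMap_eq_of_single (f := turnSum F ∘ₗ cone x ∘ₗ cone y ∘ₗ cone z) (g := 0)
    (fun l => by simp [turnSum]) c

lemma angleSum_cone_cone (x y : S) (c : List S →₀ ℤ) : angleSum F (cone x (cone y c)) = 0 :=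
  linearMap_eq_of_single (f := angleSum F ∘ₗ cone x ∘ₗ cone y) (g := 0)
    (fun l => by simp [angleSum]) c

lemma cap_cone_cone_cone (x y z : S) (c : List S →₀ ℤ) :
    cap F (cone x (cone y (cone z c))) = winding F x y z • cone z c :=
  linearMap_eq_of_single (f := cap F ∘ₗ cone x ∘ₗ cone y ∘ₗ cone z) (g := winding F x y z • cone z)
    (fun l => by simp [listCap]) c

lemma two_pi_mul_windingSum (hF : ∀ s, F s ≠ 0) (c : List S →₀ ℤ) :
    2 * Real.pi * windingSum F c = turnSum F (bdry c) := by
  let f : (List S →₀ ℤ) →ₗ[ℤ] ℝ :=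
    ((AddMonoidHom.mulLeft (2 * Real.pi)).comp (Int.castAddHom ℝ)).toIntLinearMap ∘ₗ windingSum F
  refine linearMap_eq_of_single (f := f) (g := turnSum F ∘ₗ bdry) (fun l => ?_) c
  change 2 * Real.pi * windingSum F (single l 1) = turnSum F (bdry (single l 1))
  rw [bdry_single]
  match l with
  | [] => simp [listBdry, windingSum]
  | [x] => simp [listBdry, windingSum, turnSum]
  | [x, y] => simp [listBdry, windingSum, turnSum]
  | [x, y, z] =>
    simp [listBdry, windingSum, turnSum, two_pi_mul_winding hF]
    ring
  | x :: y :: z :: t :: l =>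
    simp only [listBdry, map_sub, turnSum_cone_cone_cone]
    simp [windingSum, turnSum]

lemma turnSum_eq_angleSum (hF : ∀ s, F s ≠ 0) (c : List S →₀ ℤ) :
    ((turnSum F c : ℝ) : Real.Angle) = angleSum F (bdry c) := by
  refine linearMap_eq_of_single (f := Real.Angle.coeHom.toIntLinearMap ∘ₗ turnSum F)
    (g := angleSum F ∘ₗ bdry) (fun l => ?_) c
  change ((turnSum F (single l 1) : ℝ) : Real.Angle) = angleSum F (bdry (single l 1))
  rw [bdry_single]
  match l with
  | [] => simp [listBdry, turnSum]
  | [x] => simp [listBdry, turnSum, angleSum]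
  | [x, y] =>
    simp [listBdry, turnSum, angleSum, turn, Complex.arg_div_coe_angle (hF _) (hF _)]
  | x :: y :: z :: l =>
    simp only [listBdry, map_sub, angleSum_cone_cone]
    simp [turnSum, angleSum]

lemma winding_cocycle (hF : ∀ s, F s ≠ 0) (x y z t : S) :
    winding F y z t - winding F x z t + winding F x y t = winding F x y z := by
  have h : 2 * Real.pi * (winding F y z t - winding F x z t + winding F x y t : ℤ) =
      2 * Real.pi * winding F x y z := by
    push_cast
    rw [mul_add, mul_sub]
    simp only [two_pi_mul_winding hF]
    ring
  exact_mod_cast mul_left_cancel₀ Real.two_pi_pos.ne' h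

lemma bdry_cap (hF : ∀ s, F s ≠ 0) (c : List S →₀ ℤ) :
    bdry (cap F c) = cap F (bdry c) + single [] (windingSum F c) := by
  refine linearMap_eq_of_single (f := bdry ∘ₗ cap F)
    (g := cap F ∘ₗ bdry + Finsupp.lsingle [] ∘ₗ windingSum F) (fun l => ?_) c
  simp only [LinearMap.comp_apply, LinearMap.add_apply, bdry_single, cap_single,
    Finsupp.lsingle_apply]
  have hs : ∀ (l : List S) (n : ℤ), single l n = n • single l (1 : ℤ) := by simp
  match l with
  | [] => simp [listBdry, listCap, windingSum]
  | [x] => simp [listBdry, listCap, windingSum]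
  | [x, y] => simp [listBdry, listCap, windingSum]
  | [x, y, z] =>
    rw [listCap, hs, map_smul, bdry_single]
    simp [listBdry, listCap, windingSum]
  | x :: y :: z :: t :: l =>
    have hw : windingSum F (single (x :: y :: z :: t :: l) 1) = 0 := by simp [windingSum]
    rw [hw, listCap, hs, map_smul, bdry_single, single_zero, add_zero]
    simp only [listBdry, map_sub, cap_cone_cone_cone, cone_single, cap_single, listCap]
    rw [hs _ (winding F x y z), hs _ (winding F y z t), hs _ (winding F x z t),
      hs _ (winding F x y t), ← winding_cocycle hF x y z t]
    module

/-- Evaluation of the cup product of the winding cocycles of a list of functions. -/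
noncomputable def cupEval : List (S → ℂ) → (List S →₀ ℤ) →ₗ[ℤ] ℤ
  | [] => coeffNil ∘ₗ bdry
  | F :: Fs => cupEval Fs ∘ₗ cap F

lemma cupEval_nil_simplex (Fs : List (S → ℂ)) (n : ℤ) : cupEval Fs (single [] n) = 0 := by
  have hs : single ([] : List S) n = n • single [] (1 : ℤ) := by simp
  rw [hs, map_smul]
  rcases Fs with _ | ⟨F, Fs⟩ <;> simp [cupEval, listBdry, listCap]

lemma cupEval_bdry {Fs : List (S → ℂ)} (hFs : ∀ F ∈ Fs, ∀ s, F s ≠ 0) (c : List S →₀ ℤ) :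
    cupEval Fs (bdry c) = 0 := by
  induction Fs generalizing c with
  | nil => simp [cupEval, bdry_bdry]
  | cons F Fs ih =>
    have h := bdry_cap (hFs F List.mem_cons_self) c
    rw [← sub_eq_iff_eq_add] at h
    rw [cupEval, LinearMap.comp_apply, ← h, map_sub,
      ih (fun F' hF' => hFs F' (List.mem_cons_of_mem _ hF')), cupEval_nil_simplex, sub_zero]

variable {G : Type*} [AddGroup G] [AddAction G S]

/-- `F` transforms under the group action by the multiplier `χ`. -/
structure IsEquivariant (χ : G → ℂ) (F : S → ℂ) : Prop where
  ne_zero : ∀ s, F s ≠ 0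
  vadd : ∀ g s, F (g +ᵥ s) = χ g * F s

variable {χ : G → ℂ}

lemma IsEquivariant.turn_vadd (hF : IsEquivariant χ F) (g : G) (x y : S) :
    turn F (g +ᵥ x) (g +ᵥ y) = turn F x y := by
  have : χ g ≠ 0 := fun h => hF.ne_zero (g +ᵥ x) (by rw [hF.vadd, h, zero_mul])
  rw [turn, hF.vadd, hF.vadd, mul_div_mul_left _ _ this, turn]

lemma IsEquivariant.winding_vadd (hF : IsEquivariant χ F) (g : G) (x y z : S) :
    winding F (g +ᵥ x) (g +ᵥ y) (g +ᵥ z) = winding F x y z := by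
  simp only [winding, hF.turn_vadd]

lemma IsEquivariant.turnSum_act (hF : IsEquivariant χ F) (g : G) (c : List S →₀ ℤ) :
    turnSum F (act g c) = turnSum F c := by
  refine linearMap_eq_of_single (f := turnSum F ∘ₗ act g) (g := turnSum F) (fun l => ?_) c
  match l with
  | [] => simp [turnSum]
  | [x] => simp [turnSum]
  | [x, y] => simp [turnSum, hF.turn_vadd]
  | x :: y :: z :: l => simp [turnSum]

lemma IsEquivariant.cap_act (hF : IsEquivariant χ F) (g : G) (c : List S →₀ ℤ) :
    cap F (act g c) = act g (cap F c) := by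
  refine linearMap_eq_of_single (f := cap F ∘ₗ act g) (g := act g ∘ₗ cap F) (fun l => ?_) c
  match l with
  | [] => simp [listCap]
  | [x] => simp [listCap]
  | [x, y] => simp [listCap]
  | x :: y :: z :: l => simp [listCap, hF.winding_vadd]

lemma coeffNil_act (g : G) (c : List S →₀ ℤ) : coeffNil (act g c) = coeffNil c := by
  refine linearMap_eq_of_single (f := coeffNil ∘ₗ act g) (g := coeffNil) (fun l => ?_) c
  rcases l with _ | ⟨x, l⟩ <;> simp [coeffNil]

lemma IsEquivariant.angleSum_act (hF : IsEquivariant χ F) (g : G) (c : List S →₀ ℤ) :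
    angleSum F (act g c) = angleSum F c + coeffNil (bdry c) • ((χ g).arg : Real.Angle) := by
  refine linearMap_eq_of_single (f := angleSum F ∘ₗ act g)
    (g := angleSum F + (coeffNil ∘ₗ bdry).smulRight ((χ g).arg : Real.Angle)) (fun l => ?_) c
  match l with
  | [] => simp [angleSum, listBdry]
  | [x] =>
    have : χ g ≠ 0 := fun h => hF.ne_zero (g +ᵥ x) (by rw [hF.vadd, h, zero_mul])
    simp [angleSum, listBdry, hF.vadd, Complex.arg_mul_coe_angle this (hF.ne_zero x), coeffNil,
      add_comm]
  | x :: y :: l => 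
    have h : coeffNil (listBdry (x :: y :: l)) = 0 := by
      simp only [listBdry, map_sub, coeffNil_cone]
      simp [coeffNil]
    simp [angleSum, h]

lemma cupEval_act {Fs : List (S → ℂ)} (hFs : ∀ F ∈ Fs, ∃ χ : G → ℂ, IsEquivariant χ F) (g : G)
    (c : List S →₀ ℤ) : cupEval Fs (act g c) = cupEval Fs c := by
  induction Fs generalizing c with
  | nil => simp [cupEval, bdry_act, coeffNil_act]
  | cons F Fs ih =>
    obtain ⟨χ, hF⟩ := hFs F List.mem_cons_self
    rw [cupEval, LinearMap.comp_apply, hF.cap_act,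
      ih (fun F' hF' => hFs F' (List.mem_cons_of_mem _ hF')), LinearMap.comp_apply]

end Cochains

section Comparison

variable {k p : ℕ} [NeZero p] {S : Type*} [AddAction (Fin k → ZMod p) S]

/-- The character of `(ℤ/p)^k` attached to the linear form `v`. -/
noncomputable def char (v g : Fin k → ZMod p) : ℂ := ZMod.stdAddChar (v ⬝ᵥ g)

lemma arg_char_single (v : Fin k → ZMod p) (i : Fin k) :
    ((char v (Pi.single i 1)).arg : Real.Angle) = (2 * Real.pi * (v i).val / p : ℝ) := by
  have h : char v (Pi.single i 1) = Complex.exp ((2 * Real.pi * (v i).val / p : ℝ) * Complex.I) := by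
    have h1 := ZMod.stdAddChar_coe (N := p) ((v i).val : ℤ)
    rw [Int.cast_natCast, ZMod.natCast_rightInverse] at h1
    rw [char, dotProduct_single_one, h1]
    congr 1
    push_cast
    ring
  rw [h, Complex.arg_exp_mul_I, Real.Angle.coe_toIocMod]

/-- An equivariant augmented chain map from the resolution to the chains on `S`. -/
structure IsComparison (Ψ : (Cell k p →₀ ℤ) →ₗ[ℤ] (List S →₀ ℤ)) : Prop where
  bdry_map : ∀ x, bdry (Ψ x) = Ψ (diff x) + single [] (augment x)
  map_shift : ∀ g x, Ψ (shift g x) = act g (Ψ x)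
  mem : ∀ b, Ψ (single b 1) ∈ chainsOfLength S (degree b + 1)

/-- Linear maps agreeing on the simplices of a chain agree on the chain. -/
lemma linearMap_eq_of_single_of_mem {B M : Type*} [AddCommGroup M] {f g : (B →₀ ℤ) →ₗ[ℤ] M}
    {c : B →₀ ℤ} (h : ∀ b ∈ c.support, f (single b 1) = g (single b 1)) : f c = g c := by
  rw [← Finsupp.sum_single c, Finsupp.sum, map_sum, map_sum]
  refine Finset.sum_congr rfl fun b hb => ?_
  rw [← mul_one (c b), ← smul_eq_mul, ← Finsupp.smul_single, map_smul, map_smul, h b hb]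

lemma coeffNil_eq_zero {n : ℕ} {c : List S →₀ ℤ} (hc : c ∈ chainsOfLength S (n + 1)) :
    coeffNil c = 0 := by
  by_contra h
  simpa using (Finsupp.mem_supported _ _).1 hc (Finsupp.mem_support_iff.2 h)

lemma turnSum_eq_zero {F : S → ℂ} {n : ℕ} (hn : n ≠ 2) {c : List S →₀ ℤ}
    (hc : c ∈ chainsOfLength S n) : turnSum F c = 0 := by
  refine linearMap_eq_of_single_of_mem (f := turnSum F) (g := 0) fun l hl => ?_
  have hl : l.length = n := (Finsupp.mem_supported _ _).1 hc hl
  match l with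
  | [] => simp [turnSum]
  | [x] => simp [turnSum]
  | [x, y] => exact absurd hl.symm hn
  | x :: y :: z :: l => simp [turnSum]

omit [NeZero p] in
lemma exists_eq_single_of_degree {b : Cell k p} (hb : degree b = 1) :
    ∃ i, b.1 = Pi.single i 1 := by
  obtain ⟨i, hi⟩ : ∃ i, b.1 i ≠ 0 := by
    by_contra! h
    simp [degree, h] at hb
  have h0 : ∀ j ≠ i, b.1 j = 0 := by
    intro j hj
    have := Finset.sum_le_sum_of_subset (f := b.1) (Finset.subset_univ {i, j})
    rw [Finset.sum_pair hj.symm] at this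
    unfold degree at hb
    omega
  refine ⟨i, funext fun j => ?_⟩
  rcases eq_or_ne j i with rfl | hj
  · rw [degree, Finset.sum_eq_single j (fun j' _ h => h0 j' h) (by simp)] at hb
    simp [hb]
  · rw [h0 j hj, Pi.single_eq_of_ne hj]

namespace IsComparison

variable {Ψ : (Cell k p →₀ ℤ) →ₗ[ℤ] (List S →₀ ℤ)} (hΨ : IsComparison Ψ)
  {F : S → ℂ} {v : Fin k → ZMod p} (hF : IsEquivariant (char v) F)

include hΨ

lemma coeffNil_map (x : Cell k p →₀ ℤ) : coeffNil (Ψ x) = 0 :=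
  linearMap_eq_of_single (f := coeffNil ∘ₗ Ψ) (g := 0)
    (fun b => coeffNil_eq_zero (hΨ.mem b)) x

lemma coeffNil_bdry_map (x : Cell k p →₀ ℤ) : coeffNil (bdry (Ψ x)) = augment x := by
  rw [hΨ.bdry_map, map_add, hΨ.coeffNil_map, zero_add]
  simp [coeffNil]

include hF

lemma exists_turn_sub_slope (b : Cell k p) :
    ∃ n : ℤ, 2 * Real.pi * n = turnSum F (Ψ (single b 1)) - slope v (single b 1) := by
  by_cases hb : ∃ i, b.1 = Pi.single i 1
  · obtain ⟨i, hi⟩ := hb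
    obtain ⟨I, g⟩ := b
    obtain rfl : I = Pi.single i 1 := hi
    have hslope : slope v (single (Pi.single i 1, g) 1) = 2 * Real.pi * (v i).val / p := by
      rw [slope_single, Finset.sum_eq_single i]
      · simp
      · intro j _ hj
        rw [if_neg]
        intro h
        have := congr_fun h j
        simp [hj] at this
      · simp
    have hdiff : diff (single ((Pi.single i 1, g) : Cell k p) 1) =
        shift (Pi.single i 1) (single ((0, g) : Cell k p) 1) - single (0, g) 1 := by
      rw [diff, LinearMap.sum_apply, Finset.sum_eq_single i]
      · rw [partialDiff_single, koszulSign_single, one_smul]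
        have : Function.update (Pi.single i 1) i 0 = (0 : Fin k → ℕ) := by simp [Pi.single]
        simp [coeffOp, this]
      · intro j _ hj
        simp [partialDiff_single, hj, coeffOp_zero]
      · simp
    have h1 := turnSum_eq_angleSum hF.ne_zero (Ψ (single (Pi.single i 1, g) 1))
    rw [hΨ.bdry_map, hdiff, map_sub, hΨ.map_shift, map_add, map_sub, hF.angleSum_act,
      hΨ.coeffNil_bdry_map, arg_char_single, augment_single] at h1
    have h2 : angleSum F (single [] (augment (single (Pi.single i 1, g) (1 : ℤ)))) = 0 := by
      simp [angleSum]
    rw [h2, if_pos rfl, one_smul, add_zero, add_sub_cancel_left,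
      Real.Angle.angle_eq_iff_two_pi_dvd_sub] at h1
    obtain ⟨n, hn⟩ := h1
    exact ⟨n, by rw [hslope, hn]⟩
  · refine ⟨0, ?_⟩
    rw [turnSum_eq_zero _ (hΨ.mem b), slope_single, Finset.sum_eq_zero]
    · simp
    · intro i _
      rw [if_neg fun h => hb ⟨i, h⟩]
    · intro h
      exact hb (exists_eq_single_of_degree (by omega))

lemma exists_turn_sub_slope_linear : ∃ t : (Cell k p →₀ ℤ) →ₗ[ℤ] ℤ,
    (∀ x, 2 * Real.pi * t x = turnSum F (Ψ x) - slope v x) ∧ ∀ h x, t (shift h x) = t x := by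
  choose n hn using hΨ.exists_turn_sub_slope hF
  let t : (Cell k p →₀ ℤ) →ₗ[ℤ] ℤ := Finsupp.linearCombination ℤ n
  have ht : ∀ x, 2 * Real.pi * t x = turnSum F (Ψ x) - slope v x := by
    intro x
    let f : (Cell k p →₀ ℤ) →ₗ[ℤ] ℝ :=
      ((AddMonoidHom.mulLeft (2 * Real.pi)).comp (Int.castAddHom ℝ)).toIntLinearMap ∘ₗ t
    refine linearMap_eq_of_single (f := f) (g := turnSum F ∘ₗ Ψ - slope v) (fun b => ?_) x
    change 2 * Real.pi * t (single b 1) = _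
    simp [t, hn]
  refine ⟨t, ht, fun h x => ?_⟩
  have h1 : 2 * Real.pi * t (shift h x) = 2 * Real.pi * t x := by
    rw [ht, ht, hΨ.map_shift, hF.turnSum_act, slope_shift]
  exact_mod_cast mul_left_cancel₀ Real.two_pi_pos.ne' h1

/-- Capping with the winding cocycle is homotopic to lowering the degree. -/
lemma exists_homotopy [Nonempty S] : ∃ (t : (Cell k p →₀ ℤ) →ₗ[ℤ] ℤ)
    (H : (Cell k p →₀ ℤ) →ₗ[ℤ] (List S →₀ ℤ)),
    (∀ x, bdry (H x) = cap F (Ψ x) - Ψ (lower v x) - H (diff x) + single [] (t x)) ∧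
      ∀ g x, H (shift g x) = act g (H x) := by
  obtain ⟨t, ht, htinv⟩ := hΨ.exists_turn_sub_slope_linear hF
  obtain ⟨s₀⟩ := ‹Nonempty S›
  let D : (Cell k p →₀ ℤ) →ₗ[ℤ] (List S →₀ ℤ) :=
    cap F ∘ₗ Ψ - Ψ ∘ₗ lower v + Finsupp.lsingle [] ∘ₗ t
  have hDdef : ∀ x, D x = cap F (Ψ x) - Ψ (lower v x) + single [] (t x) := fun x => rfl
  have hDshift : ∀ g x, D (shift g x) = act g (D x) := by
    intro g x
    have hl := LinearMap.congr_fun (commute_shift_lower g v).eq x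
    simp only [Module.End.mul_apply] at hl
    rw [hDdef, hDdef, hΨ.map_shift, hF.cap_act, ← hl, hΨ.map_shift, htinv]
    simp
  have hD : ∀ x, bdry (D x) = D (diff x) := by
    intro x
    have h1 : windingSum F (Ψ x) - augment (lower v x) = t (diff x) := by
      have h2 : 2 * Real.pi * (windingSum F (Ψ x) - augment (lower v x) : ℤ) =
          2 * Real.pi * t (diff x) := by
        push_cast
        rw [mul_sub, two_pi_mul_windingSum hF.ne_zero, two_pi_mul_augment_lower, ht, hΨ.bdry_map,
          map_add]
        simp [turnSum]
      exact_mod_cast mul_left_cancel₀ Real.two_pi_pos.ne' h2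
    have h3 : ∀ n : ℤ, cap F (single [] n) = 0 := fun n => by simp [cap, listCap]
    have h4 : ∀ n : ℤ, bdry (single ([] : List S) n) = 0 := fun n => by simp [bdry, listBdry]
    rw [hDdef, hDdef, ← h1, lower_diff, map_add, map_sub, bdry_cap hF.ne_zero, hΨ.bdry_map,
      hΨ.bdry_map, map_add, h3, h4, single_sub]
    abel
  obtain ⟨H, hH⟩ := exists_recursive_linearMap degree (diff (k := k) (p := p))
    (fun b b' => degree_lt_of_mem_diff) fun b y => cone (b.2 +ᵥ s₀) (D (single b 1) - y)
  refine ⟨t, H, fun x => ?_, fun g x => ?_⟩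
  · have key : ∀ n, ∀ b : Cell k p, degree b = n →
        bdry (H (single b 1)) = D (single b 1) - H (diff (single b 1)) := by
      intro n
      induction n using Nat.strong_induction_on with
      | _ n ih =>
        intro b hb
        have h1 : bdry (H (diff (single b 1))) = D (diff (single b 1)) := by
          have := linearMap_eq_of_single_of_mem (f := bdry ∘ₗ H) (g := D - H ∘ₗ diff)
            (c := diff (single b 1))
            fun b' hb' => ih _ (hb ▸ degree_lt_of_mem_diff hb') b' rfl
          simpa [diff_diff] using this
        rw [hH, bdry_cone, map_sub, hD, h1, sub_self, map_zero, sub_zero]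
    have := linearMap_eq_of_single (f := bdry ∘ₗ H) (g := D - H ∘ₗ diff)
      (fun b => key _ b rfl) x
    rw [LinearMap.comp_apply, LinearMap.sub_apply, hDdef, LinearMap.comp_apply] at this
    rw [this]
    abel
  · have key : ∀ n, ∀ b : Cell k p, degree b = n →
        H (shift g (single b 1)) = act g (H (single b 1)) := by
      intro n
      induction n using Nat.strong_induction_on with
      | _ n ih =>
        intro b hb
        have h1 : H (shift g (diff (single b 1))) = act g (H (diff (single b 1))) :=
          linearMap_eq_of_single_of_mem (f := H ∘ₗ shift g) (g := act g ∘ₗ H)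
            fun b' hb' => ih _ (hb ▸ degree_lt_of_mem_diff hb') b' rfl
        have hd := LinearMap.congr_fun (commute_shift_diff (k := k) g).eq (single b 1)
        simp only [Module.End.mul_apply] at hd
        have hs := hDshift g (single b 1)
        rw [hH b, act_cone, map_sub, ← h1, ← hs, hd, shift_single, hH, add_vadd]
    exact linearMap_eq_of_single (f := H ∘ₗ shift g) (g := act g ∘ₗ H) (fun b => key _ b rfl) x

omit hF

open MvPolynomial in
/-- Modulo `p`, the cup products of winding cocycles are computed in the polynomial ring. -/
theorem cupEval_map [Nonempty S] (Cs : List ((Fin k → ZMod p) × (S → ℂ)))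
    (hCs : ∀ c ∈ Cs, IsEquivariant (char c.1) c.2) (a : Fin k →₀ ℕ) :
    (cupEval (Cs.map Prod.snd) (Ψ (single (fun i => 2 * a i, 0) 1)) : ZMod p) =
      coeff a (Cs.map fun c => ∑ i, C (c.1 i) * X i).prod := by
  induction Cs generalizing a with
  | nil =>
    rw [List.map_nil, cupEval, LinearMap.comp_apply, hΨ.coeffNil_bdry_map, augment_single,
      List.map_nil, List.prod_nil, coeff_one]
    have : (fun i => 2 * a i) = (0 : Fin k → ℕ) ↔ 0 = a := by
      constructor
      · intro h
        ext i
        have := congr_fun h i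
        simp at this
        simp [this]
      · rintro rfl
        rfl
    simp only [this]
    split_ifs <;> simp
  | cons c Cs ih =>
    have hc := hCs c List.mem_cons_self
    have hCs' : ∀ c ∈ Cs, IsEquivariant (char c.1) c.2 :=
      fun c' hc' => hCs c' (List.mem_cons_of_mem _ hc')
    obtain ⟨t, H, hH, hHshift⟩ := hΨ.exists_homotopy hc
    set e : Cell k p →₀ ℤ := single (fun i => 2 * a i, 0) 1 with he
    set u := cupEval (Cs.map Prod.snd) with hu
    have h1 : u (cap c.2 (Ψ e)) = u (Ψ (lower c.1 e)) + u (H (diff e)) := by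
      have h2 : u (bdry (H e)) = 0 := by
        refine cupEval_bdry ?_ _
        intro F hF
        obtain ⟨c', hc', rfl⟩ := List.mem_map.1 hF
        exact (hCs' c' hc').ne_zero
      rw [hH, map_add, map_sub, map_sub, hu, cupEval_nil_simplex] at h2
      linarith
    have h3 : (p : ℤ) ∣ u (H (diff e)) := by
      refine dvd_map_diff_of_even (φ := u ∘ₗ H) (fun h x => ?_) fun i => ⟨a i, two_mul _⟩
      rw [LinearMap.comp_apply, hHshift, hu, cupEval_act, LinearMap.comp_apply]
      intro F hF
      obtain ⟨c', hc', rfl⟩ := List.mem_map.1 hF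
      exact ⟨_, hCs' c' hc'⟩
    rw [List.map_cons, List.map_cons, List.prod_cons, cupEval, LinearMap.comp_apply, ← hu, h1,
      Int.cast_add, (ZMod.intCast_zmod_eq_zero_iff_dvd _ p).2 h3, add_zero, lower,
      LinearMap.sum_apply, map_sum, map_sum, Int.cast_sum, Finset.sum_mul, coeff_sum]
    refine Finset.sum_congr rfl fun i _ => ?_
    rw [mul_assoc, coeff_C_mul, coeff_X_mul', LinearMap.smul_apply, map_smul, map_smul,
      smul_eq_mul, Int.cast_mul, Int.cast_natCast, ZMod.natCast_rightInverse, he, lowerAt_single]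
    congr 1
    by_cases hi : i ∈ a.support
    · have hi' : a i ≠ 0 := Finsupp.mem_support_iff.1 hi
      rw [if_pos (by dsimp only; omega), if_pos hi, ← ih hCs' (a - single i 1)]
      congr 6
      ext j
      rcases eq_or_ne j i with rfl | hj
      · simp
        omega
      · simp [hj]
    · have hi' : a i = 0 := by simpa using hi
      rw [if_neg (by dsimp only; omega), if_neg hi]
      simp

end IsComparison

end Comparison

lemma exists_mem_support_of_mem_map {B B' : Type*} {f : (B →₀ ℤ) →ₗ[ℤ] (B' →₀ ℤ)} {c : B →₀ ℤ}
    {b' : B'} (h : b' ∈ (f c).support) : ∃ b ∈ c.support, b' ∈ (f (single b 1)).support := by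
  by_contra! hc
  refine Finsupp.mem_support_iff.1 h (linearMap_eq_of_single_of_mem (f := Finsupp.lapply b' ∘ₗ f)
    (g := 0) fun b hb => ?_)
  simpa using hc b hb

section Points

variable {G : Type*} {n : ℕ}

/-- Points of the space of weights on `G × Fin n`, labelled by an element of `G`. -/
def Pt (G : Type*) (n : ℕ) := (G → Fin n → ℝ) × G

/-- The weights of a labelled point. -/
def Pt.weight (s : Pt G n) : G → Fin n → ℝ := s.1

/-- The label of a labelled point. -/
def Pt.label (s : Pt G n) : G := s.2

instance [Nonempty G] : Nonempty (Pt G n) := ‹Nonempty G›.elim fun g => ⟨(0, g)⟩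

instance [AddCommGroup G] : AddAction G (Pt G n) where
  vadd g s := (fun h => s.1 (h - g), g + s.2)
  zero_vadd s := Prod.ext (funext fun h => congrArg s.1 (sub_zero h)) (zero_add _)
  add_vadd g h s := Prod.ext (funext fun x => congrArg s.1 (sub_add_eq_sub_sub x g h)) (add_assoc _ _ _)

@[simp] lemma weight_vadd [AddCommGroup G] (g : G) (s : Pt G n) (h : G) :
    (g +ᵥ s).weight h = s.weight (h - g) := rfl

@[simp] lemma label_vadd [AddCommGroup G] (g : G) (s : Pt G n) :
    (g +ᵥ s).label = g + s.label := rfl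

/-- The centroid of a nonempty list of points, labelled as the first one. -/
noncomputable def centroid (s : Pt G n) (l : List (Pt G n)) : Pt G n :=
  (((l.length + 1 : ℕ) : ℝ)⁻¹ • ((s :: l).map Pt.weight).sum, s.label)

lemma weight_centroid (s : Pt G n) (l : List (Pt G n)) : (centroid s l).weight =
    ((l.length + 1 : ℕ) : ℝ)⁻¹ • ((s :: l).map Pt.weight).sum := rfl

lemma sum_weight_apply (l : List (Pt G n)) (h : G) :
    (l.map Pt.weight).sum h = (l.map fun s => s.weight h).sum := by
  induction l with
  | nil => rfl
  | cons s l ih => simp [ih]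

lemma centroid_vadd [AddCommGroup G] (g : G) (s : Pt G n) (l : List (Pt G n)) :
    centroid (g +ᵥ s) (l.map (g +ᵥ ·)) = g +ᵥ centroid s l := by
  refine Prod.ext (funext fun h => ?_) rfl
  change (centroid (g +ᵥ s) (l.map (g +ᵥ ·))).weight h = (centroid s l).weight (h - g)
  rw [weight_centroid, weight_centroid, Pi.smul_apply, Pi.smul_apply, sum_weight_apply,
    sum_weight_apply, List.length_map]
  simp [Function.comp_def]

lemma exists_subdivision (G : Type*) (n : ℕ) :
    ∃ Φ : (List (Pt G n) →₀ ℤ) →ₗ[ℤ] (List (Pt G n) →₀ ℤ), Φ (single [] 1) = single [] 1 ∧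
      ∀ s l, Φ (single (s :: l) 1) = cone (centroid s l) (Φ (listBdry (s :: l))) := by
  obtain ⟨Φ, hΦ⟩ := exists_recursive_linearMap (M := List (Pt G n) →₀ ℤ) List.length
    (bdry (S := Pt G n)) (fun b b' hb' => length_lt_of_mem_listBdry (by simpa using hb'))
    fun l y => match l with
      | [] => single [] 1
      | s :: l => cone (centroid s l) y
  exact ⟨Φ, by rw [hΦ], fun s l => by rw [hΦ, bdry_single]⟩

/-- Barycentric subdivision. -/
noncomputable def subdivision : (List (Pt G n) →₀ ℤ) →ₗ[ℤ] (List (Pt G n) →₀ ℤ) :=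
  (exists_subdivision G n).choose

lemma subdivision_nil : subdivision (single ([] : List (Pt G n)) 1) = single [] 1 :=
  (exists_subdivision G n).choose_spec.1

lemma subdivision_cons (s : Pt G n) (l : List (Pt G n)) :
    subdivision (single (s :: l) 1) = cone (centroid s l) (subdivision (listBdry (s :: l))) :=
  (exists_subdivision G n).choose_spec.2 s l

/-- Induction over simplices, assuming the claim for all simplices of the boundary. -/
lemma induction_on_listBdry {S : Type*} {P : List S → Prop} (nil : P [])
    (cons : ∀ s l, (∀ l' ∈ (listBdry (s :: l)).support, P l') → P (s :: l)) (l : List S) : P l := by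
  induction hl : l.length using Nat.strong_induction_on generalizing l with
  | _ m ih =>
    rcases l with _ | ⟨s, l⟩
    · exact nil
    · exact cons s l fun l' hl' => ih _ (hl ▸ length_lt_of_mem_listBdry hl') l' rfl

lemma bdry_subdivision (c : List (Pt G n) →₀ ℤ) :
    bdry (subdivision c) = subdivision (bdry c) := by
  refine linearMap_eq_of_single (f := bdry ∘ₗ subdivision) (g := subdivision ∘ₗ bdry) (fun l => ?_) c
  induction l using induction_on_listBdry with
  | nil => simp [subdivision_nil, listBdry]
  | cons s l ih =>
    have h1 : bdry (subdivision (listBdry (s :: l))) = subdivision (bdry (listBdry (s :: l))) :=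
      linearMap_eq_of_single_of_mem (f := bdry ∘ₗ subdivision) (g := subdivision ∘ₗ bdry) ih
    rw [← bdry_single, bdry_bdry, map_zero] at h1
    rw [LinearMap.comp_apply, subdivision_cons, bdry_cone, ← bdry_single, h1, map_zero, sub_zero]
    rfl

lemma subdivision_act [AddCommGroup G] (g : G) (c : List (Pt G n) →₀ ℤ) :
    subdivision (act g c) = act g (subdivision c) := by
  refine linearMap_eq_of_single (f := subdivision ∘ₗ act g) (g := act g ∘ₗ subdivision)
    (fun l => ?_) c
  induction l using induction_on_listBdry with
  | nil => simp [subdivision_nil]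
  | cons s l ih =>
    have h1 := linearMap_eq_of_single_of_mem (f := subdivision ∘ₗ act g)
      (g := act g ∘ₗ subdivision) ih
    have h2 := bdry_act g (single (s :: l) 1)
    simp only [LinearMap.comp_apply, act_single, List.map_cons, bdry_single] at h1 h2 ⊢
    rw [subdivision_cons, subdivision_cons, act_cone, ← h1, h2, centroid_vadd]

lemma mem_cone_support {S : Type*} {x : S} {c : List S →₀ ℤ} {l : List S}
    (h : l ∈ (cone x c).support) : ∃ l' ∈ c.support, l = x :: l' := by
  classical
  obtain ⟨l', hl', rfl⟩ := Finset.mem_image.1 (Finsupp.mapDomain_support h)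
  exact ⟨l', hl', rfl⟩

lemma subdivision_mem (l : List (Pt G n)) :
    subdivision (single l 1) ∈ chainsOfLength (Pt G n) l.length := by
  induction l using induction_on_listBdry with
  | nil => rw [subdivision_nil]; exact Finsupp.single_mem_supported ℤ 1 (by simp)
  | cons s l ih =>
    rw [subdivision_cons]
    refine cone_mem ((Finsupp.mem_supported _ _).2 fun l'' hl'' => ?_)
    obtain ⟨l', hl', hm⟩ := exists_mem_support_of_mem_map hl''
    have h1 : l'.length = (s :: l).length - 1 := (Finsupp.mem_supported _ _).1 (listBdry_mem _) hl'
    have h2 : l''.length = l'.length := (Finsupp.mem_supported _ _).1 (ih l' hl') hm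
    rw [Set.mem_ofPred_eq, h2, h1, List.length_cons, Nat.add_sub_cancel]

lemma centroid_mem_convexHull (s : Pt G n) (l : List (Pt G n)) :
    (centroid s l).weight ∈ convexHull ℝ {w | ∃ t ∈ s :: l, t.weight = w} := by
  have h : (centroid s l).weight = ∑ i : Fin (s :: l).length,
      ((l.length + 1 : ℕ) : ℝ)⁻¹ • ((s :: l).get i).weight := by
    rw [weight_centroid, ← Finset.smul_sum]
    congr 1
    conv_lhs => rw [← List.ofFn_get (s :: l)]
    rw [List.map_ofFn, List.sum_ofFn]
    rfl
  rw [h]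
  refine (convex_convexHull ℝ _).sum_mem (fun _ _ => by positivity) ?_ fun i _ =>
    subset_convexHull ℝ _ ⟨_, List.get_mem _ _, rfl⟩
  simp
  field_simp

lemma mem_convexHull_of_mem_subdivision {l l' : List (Pt G n)}
    (h : l' ∈ (subdivision (single l 1)).support) :
    ∀ x ∈ l', x.weight ∈ convexHull ℝ {w | ∃ t ∈ l, t.weight = w} := by
  induction l using induction_on_listBdry generalizing l' with
  | nil =>
    rw [subdivision_nil] at h
    obtain rfl := Finset.mem_singleton.1 (Finsupp.support_single_subset h)
    simp
  | cons s l ih =>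
    rw [subdivision_cons] at h
    obtain ⟨l'', hl'', rfl⟩ := mem_cone_support h
    obtain ⟨f, hf, hm⟩ := exists_mem_support_of_mem_map hl''
    intro x hx
    rcases List.mem_cons.1 hx with rfl | hx
    · exact centroid_mem_convexHull s l
    · refine convexHull_mono ?_ (ih f hf hm x hx)
      rintro w ⟨t, ht, rfl⟩
      exact ⟨t, (sublist_of_mem_listBdry hf).subset ht, rfl⟩

variable [Fintype G]

lemma norm_sum_sub_le {E : Type*} [SeminormedAddCommGroup E] {l : List E} {D : ℝ} {x : E}
    (h : ∀ y ∈ l, ‖y - x‖ ≤ D) : ‖l.sum - l.length • x‖ ≤ l.length * D := by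
  induction l with
  | nil => simp
  | cons y l ih =>
    have h1 := h y List.mem_cons_self
    have h2 := ih fun y hy => h y (List.mem_cons_of_mem _ hy)
    have h3 : (y :: l).sum - (y :: l).length • x = (y - x) + (l.sum - l.length • x) := by
      rw [List.sum_cons, List.length_cons, succ_nsmul]
      abel
    rw [h3, List.length_cons]
    push_cast
    linarith [norm_add_le (y - x) (l.sum - l.length • x)]

/-- The centroid is closer to the points of the list than the diameter. -/
lemma dist_centroid_le {s : Pt G n} {l : List (Pt G n)} {D : ℝ}
    (h : ∀ x ∈ s :: l, ∀ y ∈ s :: l, dist x.weight y.weight ≤ D) {w : G → Fin n → ℝ}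
    (hw : w ∈ convexHull ℝ {w | ∃ t ∈ s :: l, t.weight = w}) :
    dist w (centroid s l).weight ≤ l.length / (l.length + 1) * D := by
  suffices {w | ∃ t ∈ s :: l, t.weight = w} ⊆
      Metric.closedBall (centroid s l).weight (l.length / (l.length + 1) * D) from
    convexHull_min this (convex_closedBall _ _) hw
  rintro _ ⟨t, ht, rfl⟩
  rw [Metric.mem_closedBall, dist_comm, dist_eq_norm]
  obtain ⟨l₁, l₂, hl⟩ := List.append_of_mem ht
  have h1 := norm_sum_sub_le (l := (l₁ ++ l₂).map Pt.weight) (D := D) (x := t.weight) (by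
    intro y hy
    obtain ⟨y, hy₀, rfl⟩ := List.mem_map.1 hy
    rw [← dist_eq_norm]
    refine h y ?_ t ht
    rw [hl]
    have := List.mem_append.1 hy₀
    simp only [List.mem_append, List.mem_cons]
    tauto)
  have hlen : l.length = (l₁ ++ l₂).length := by
    have := congrArg List.length hl
    simp at this ⊢
    omega
  have hsum : ((s :: l).map Pt.weight).sum = t.weight + ((l₁ ++ l₂).map Pt.weight).sum := by
    rw [hl]
    simp
    abel
  have hpos : (0 : ℝ) < l.length + 1 := by positivity
  have h2 : (centroid s l).weight - t.weight = ((l.length : ℝ) + 1)⁻¹ •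
      (((l₁ ++ l₂).map Pt.weight).sum - ((l₁ ++ l₂).map Pt.weight).length • t.weight) := by
    rw [weight_centroid, hsum, List.length_map, ← hlen, Nat.cast_add_one, ← Nat.cast_smul_eq_nsmul ℝ]
    have h3 : t.weight = ((l.length : ℝ) + 1)⁻¹ • ((l.length : ℝ) + 1) • t.weight := by
      rw [smul_smul, inv_mul_cancel₀ hpos.ne', one_smul]
    nth_rewrite 2 [h3]
    module
  rw [List.length_map, ← hlen] at h1
  rw [h2, norm_smul, Real.norm_of_nonneg (by positivity), List.length_map, ← hlen]
  calc _ ≤ ((l.length : ℝ) + 1)⁻¹ * (l.length * D) := by gcongr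
    _ = _ := by field_simp

lemma dist_le_of_mem_subdivision {N : ℕ} {D : ℝ} {l l' : List (Pt G n)} (hN : l.length ≤ N + 1)
    (hD : ∀ x ∈ l, ∀ y ∈ l, dist x.weight y.weight ≤ D)
    (h : l' ∈ (subdivision (single l 1)).support) :
    ∀ x ∈ l', ∀ y ∈ l', dist x.weight y.weight ≤ N / (N + 1) * D := by
  induction l using induction_on_listBdry generalizing l' with
  | nil =>
    rw [subdivision_nil] at h
    obtain rfl := Finset.mem_singleton.1 (Finsupp.support_single_subset h)
    simp
  | cons s l ih =>
    have hhull := mem_convexHull_of_mem_subdivision h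
    rw [subdivision_cons] at h
    obtain ⟨l'', hl'', rfl⟩ := mem_cone_support h
    obtain ⟨f, hf, hm⟩ := exists_mem_support_of_mem_map hl''
    have hsub := sublist_of_mem_listBdry hf
    have ih' := ih f hf (hsub.length_le.trans hN)
      (fun x hx y hy => hD x (hsub.subset hx) y (hsub.subset hy)) hm
    have hD0 : 0 ≤ D := dist_nonneg.trans (hD s List.mem_cons_self s List.mem_cons_self)
    have hle : (l.length / (l.length + 1) * D : ℝ) ≤ N / (N + 1) * D := by
      have : (l.length : ℝ) ≤ N := by exact_mod_cast Nat.le_of_succ_le_succ hN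
      refine mul_le_mul_of_nonneg_right ?_ hD0
      rw [div_le_div_iff₀ (by positivity) (by positivity)]
      linarith
    have hc : ∀ y ∈ centroid s l :: l'',
        dist y.weight (centroid s l).weight ≤ N / (N + 1) * D := fun y hy =>
      (dist_centroid_le hD (hhull y hy)).trans hle
    intro x hx y hy
    rcases List.mem_cons.1 hx with rfl | hx'
    · rw [dist_comm]
      exact hc y hy
    · rcases List.mem_cons.1 hy with rfl | hy'
      · exact hc x hx
      · exact ih' x hx' y hy'

end Points

section Fine

variable {k p n : ℕ} [NeZero p]

omit [NeZero p] in
lemma augment_shift (h : Fin k → ZMod p) (c : Cell k p →₀ ℤ) : augment (shift h c) = augment c :=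
  linearMap_eq_of_single (f := augment ∘ₗ shift h) (g := augment)
    (fun b => by simp [augment_single]) c

lemma augment_diff (c : Cell k p →₀ ℤ) : augment (diff c) = 0 := by
  refine linearMap_eq_of_single (f := augment ∘ₗ diff) (g := 0) (fun b => ?_) c
  rw [LinearMap.comp_apply, diff, LinearMap.sum_apply, map_sum]
  refine Finset.sum_eq_zero fun i _ => ?_
  rw [partialDiff_single, map_smul, map_coeffOp_of_invariant augment_shift, augment_single]
  split_ifs with h1 h2 h3
  · simp
  · simp
  · have := congr_fun h3 i
    simp only [Function.update_self, Pi.zero_apply] at this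
    exact absurd (show Odd (b.1 i) by rw [show b.1 i = 1 by omega]; exact odd_one) h2
  · simp

/-- The vertex `(g, j)`, for `j` at most `n`. -/
def vertex (n : ℕ) (g : Fin k → ZMod p) (j : ℕ) : Pt (Fin k → ZMod p) n :=
  (Pi.single g fun i : Fin n => if (i : ℕ) = j then 1 else 0, g)

omit [NeZero p] in
lemma weight_vertex (g : Fin k → ZMod p) (j : ℕ) : (vertex n g j).weight =
    Pi.single g fun i : Fin n => if (i : ℕ) = j then 1 else 0 := rfl

omit [NeZero p] in
lemma vertex_vadd (h g : Fin k → ZMod p) (j : ℕ) : vertex n (h + g) j = h +ᵥ vertex n g j := by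
  refine Prod.ext (funext fun x => ?_) rfl
  change (vertex n (h + g) j).weight x = (vertex n g j).weight (x - h)
  rw [weight_vertex, weight_vertex, Pi.single_apply, Pi.single_apply]
  simp only [sub_eq_iff_eq_add']

/-- Weights of total mass one, supported on the graph of `γ`. -/
def graphSimplex (γ : Fin n → Fin k → ZMod p) : Set ((Fin k → ZMod p) → Fin n → ℝ) :=
  {w | (∀ g i, 0 ≤ w g i) ∧ (∀ g i, g ≠ γ i → w g i = 0) ∧ ∑ g, ∑ i, w g i = 1}

lemma convex_graphSimplex (γ : Fin n → Fin k → ZMod p) : Convex ℝ (graphSimplex γ) := by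
  rintro w ⟨h1, h2, h3⟩ w' ⟨h1', h2', h3'⟩ a b ha hb hab
  refine ⟨fun g i => ?_, fun g i hg => ?_, ?_⟩
  · have := h1 g i
    have := h1' g i
    simp only [Pi.add_apply, Pi.smul_apply, smul_eq_mul]
    positivity
  · simp [h2 g i hg, h2' g i hg]
  · simp only [Pi.add_apply, Pi.smul_apply, smul_eq_mul, Finset.sum_add_distrib, ← Finset.mul_sum,
      h3, h3', mul_one, hab]

lemma exists_vertex_comparison (k p n : ℕ) [NeZero p] :
    ∃ Φ : (Cell k p →₀ ℤ) →ₗ[ℤ] (List (Pt (Fin k → ZMod p) n) →₀ ℤ), IsComparison Φ ∧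
      ∀ b, ∀ l ∈ (Φ (single b 1)).support, ∃ γ : ℕ → Fin k → ZMod p,
        ∀ s ∈ l, ∃ j ≤ degree b, s = vertex n (γ j) j := by
  obtain ⟨Φ, hΦ⟩ := exists_recursive_linearMap (M := List (Pt (Fin k → ZMod p) n) →₀ ℤ) degree
    (diff (k := k) (p := p)) (fun b b' => degree_lt_of_mem_diff)
    fun b y => cone (vertex n b.2 (degree b)) (y + single [] (augment (single b 1)))
  have ind : ∀ {P : Cell k p → Prop},
      (∀ b, (∀ b' ∈ (diff (single b 1)).support, P b') → P b) → ∀ b, P b := by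
    intro P h b
    induction hd : degree b using Nat.strong_induction_on generalizing b with
    | _ m ih => exact h b fun b' hb' => ih _ (hd ▸ degree_lt_of_mem_diff hb') b' rfl
  have hnil : ∀ m : ℤ, bdry (single ([] : List (Pt (Fin k → ZMod p) n)) m) = 0 := fun m => by
    simp [bdry, listBdry]
  refine ⟨Φ, ⟨fun x => ?_, fun g x => ?_, fun b => ?_⟩, fun b => ?_⟩
  · refine linearMap_eq_of_single (f := bdry ∘ₗ Φ) (g := Φ ∘ₗ diff + Finsupp.lsingle [] ∘ₗ augment)
      (fun b => ?_) x
    induction b using ind with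
    | _ b ih =>
      have h1 := linearMap_eq_of_single_of_mem (f := bdry ∘ₗ Φ)
        (g := Φ ∘ₗ diff + Finsupp.lsingle [] ∘ₗ augment) ih
      simp only [LinearMap.comp_apply, LinearMap.add_apply, diff_diff, augment_diff, map_zero,
        add_zero, Finsupp.lsingle_apply] at h1 ⊢
      rw [hΦ, bdry_cone, map_add, h1, hnil, add_zero, map_zero, sub_zero]
  · refine linearMap_eq_of_single (f := Φ ∘ₗ shift g) (g := act g ∘ₗ Φ) (fun b => ?_) x
    induction b using ind with
    | _ b ih =>
      have h1 := linearMap_eq_of_single_of_mem (f := Φ ∘ₗ shift g) (g := act g ∘ₗ Φ) ih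
      have hd := LinearMap.congr_fun (commute_shift_diff (k := k) g).eq (single b 1)
      simp only [Module.End.mul_apply] at hd
      have ha := augment_shift g (single b 1)
      simp only [LinearMap.comp_apply] at h1 ⊢
      rw [hΦ b, act_cone, map_add, ← h1, hd, shift_single, hΦ, act_single, List.map_nil,
        ← vertex_vadd, ← ha, shift_single]
      rfl
  · induction b using ind with
    | _ b ih =>
      rw [hΦ]
      refine cone_mem (Submodule.add_mem _ ?_ ?_)
      · refine (Finsupp.mem_supported _ _).2 fun l hl => ?_
        obtain ⟨b', hb', hl'⟩ := exists_mem_support_of_mem_map hl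
        have h1 : l.length = degree b' + 1 := (Finsupp.mem_supported _ _).1 (ih b' hb') hl'
        rcases hd : degree b with _ | m
        · simp [diff_of_degree_zero hd] at hb'
        · have h2 : degree b' = m := (Finsupp.mem_supported _ _).1 (diff_mem hd) hb'
          rw [Set.mem_ofPred_eq, h1, h2]
      · rw [augment_single]
        split_ifs with h
        · exact Finsupp.single_mem_supported ℤ 1 (by simp [degree, h])
        · simp
  · classical
    induction b using ind with
    | _ b ih =>
      intro l hl
      rw [hΦ] at hl
      obtain ⟨l', hl', rfl⟩ := mem_cone_support hl
      suffices ∃ γ : ℕ → Fin k → ZMod p, ∀ s ∈ l', ∃ j < degree b, s = vertex n (γ j) j by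
        obtain ⟨γ, hγ⟩ := this
        refine ⟨Function.update γ (degree b) b.2, fun s hs => ?_⟩
        rcases List.mem_cons.1 hs with rfl | hs
        · exact ⟨_, le_rfl, by simp⟩
        · obtain ⟨j, hj, rfl⟩ := hγ s hs
          exact ⟨j, hj.le, by rw [Function.update_of_ne hj.ne]⟩
      rcases Finset.mem_union.1 (Finsupp.support_add hl') with h | h
      · obtain ⟨b', hb', hm⟩ := exists_mem_support_of_mem_map h
        obtain ⟨γ, hγ⟩ := ih b' hb' l' hm
        refine ⟨γ, fun s hs => ?_⟩
        obtain ⟨j, hj, rfl⟩ := hγ s hs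
        exact ⟨j, hj.trans_lt (degree_lt_of_mem_diff hb'), rfl⟩
      · obtain rfl := Finset.mem_singleton.1 (Finsupp.support_single_subset h)
        exact ⟨0, by simp⟩

lemma weight_vertex_mem {γ : ℕ → Fin k → ZMod p} {j : ℕ} (hj : j < n) :
    (vertex n (γ j) j).weight ∈ graphSimplex fun i : Fin n => γ i := by
  refine ⟨fun g i => ?_, fun g i hg => ?_, ?_⟩
  · rw [weight_vertex, Pi.single_apply]
    split_ifs
    · dsimp only
      split_ifs <;> simp
    · simp
  · rw [weight_vertex, Pi.single_apply]
    split_ifs with h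
    · dsimp only
      rw [if_neg]
      rintro rfl
      exact hg h
    · simp
  · rw [weight_vertex, Finset.sum_eq_single (γ j) (fun g _ hg => by simp [hg]) (by simp),
      Pi.single_eq_same, Finset.sum_eq_single ⟨j, hj⟩]
    · simp
    · intro i _ hi
      rw [if_neg fun h => hi (Fin.ext h)]
    · simp

lemma dist_le_one_of_mem {γ : Fin n → Fin k → ZMod p} {w w' : (Fin k → ZMod p) → Fin n → ℝ}
    (hw : w ∈ graphSimplex γ) (hw' : w' ∈ graphSimplex γ) : dist w w' ≤ 1 := by
  have key : ∀ {w}, w ∈ graphSimplex γ → ∀ g i, w g i ≤ 1 := by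
    rintro w ⟨h1, _, h3⟩ g i
    rw [← h3]
    exact (Finset.single_le_sum (fun i _ => h1 g i) (Finset.mem_univ i)).trans
      (Finset.single_le_sum (f := fun g => ∑ i, w g i)
        (fun g _ => Finset.sum_nonneg fun i _ => h1 g i) (Finset.mem_univ g))
  refine (dist_pi_le_iff zero_le_one).2 fun g => (dist_pi_le_iff zero_le_one).2 fun i => ?_
  rw [Real.dist_eq, abs_le]
  have := key hw g i
  have := key hw' g i
  have := hw.1 g i
  have := hw'.1 g i
  constructor <;> linarith

lemma IsComparison.subdivision_comp
    {Ψ : (Cell k p →₀ ℤ) →ₗ[ℤ] (List (Pt (Fin k → ZMod p) n) →₀ ℤ)} (hΨ : IsComparison Ψ) :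
    IsComparison (subdivision ∘ₗ Ψ) where
  bdry_map x := by
    have h : ∀ m : ℤ, single ([] : List (Pt (Fin k → ZMod p) n)) m = m • single [] (1 : ℤ) := by simp
    rw [LinearMap.comp_apply, bdry_subdivision, hΨ.bdry_map, map_add, h, map_smul, subdivision_nil]
    rfl
  map_shift g x := by
    rw [LinearMap.comp_apply, hΨ.map_shift, subdivision_act, LinearMap.comp_apply]
  mem b := by
    refine (Finsupp.mem_supported _ _).2 fun l hl => ?_
    obtain ⟨l', hl', hm⟩ := exists_mem_support_of_mem_map (f := subdivision) hl
    have h1 : l'.length = _ := (Finsupp.mem_supported _ _).1 (hΨ.mem b) hl'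
    have h2 : l.length = _ := (Finsupp.mem_supported _ _).1 (subdivision_mem l') hm
    rw [Set.mem_ofPred_eq, h2, h1]

/-- There are comparison maps all of whose simplices are small. -/
lemma exists_fine_comparison (k p N : ℕ) [NeZero p] {δ : ℝ} (hδ : 0 < δ) :
    ∃ Ψ : (Cell k p →₀ ℤ) →ₗ[ℤ] (List (Pt (Fin k → ZMod p) (N + 1)) →₀ ℤ), IsComparison Ψ ∧
      ∀ b, degree b ≤ N → ∀ l ∈ (Ψ (single b 1)).support,
        (∃ γ, ∀ x ∈ l, x.weight ∈ graphSimplex γ) ∧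
          ∀ x ∈ l, ∀ y ∈ l, dist x.weight y.weight < δ := by
  suffices ∀ M : ℕ, ∃ Ψ : (Cell k p →₀ ℤ) →ₗ[ℤ] (List (Pt (Fin k → ZMod p) (N + 1)) →₀ ℤ),
      IsComparison Ψ ∧ ∀ b, degree b ≤ N → ∀ l ∈ (Ψ (single b 1)).support,
        (∃ γ, ∀ x ∈ l, x.weight ∈ graphSimplex γ) ∧
          ∀ x ∈ l, ∀ y ∈ l, dist x.weight y.weight ≤ (N / (N + 1) : ℝ) ^ M by
    have hlt : (N / (N + 1) : ℝ) < 1 := by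
      rw [div_lt_one (by positivity)]
      linarith
    obtain ⟨M, hM⟩ := exists_pow_lt_of_lt_one hδ hlt
    obtain ⟨Ψ, hΨ, h⟩ := this M
    exact ⟨Ψ, hΨ, fun b hb l hl => ⟨(h b hb l hl).1, fun x hx y hy =>
      ((h b hb l hl).2 x hx y hy).trans_lt hM⟩⟩
  intro M
  induction M with
  | zero =>
    obtain ⟨Φ, hΦ, h⟩ := exists_vertex_comparison k p (N + 1)
    refine ⟨Φ, hΦ, fun b hb l hl => ?_⟩
    obtain ⟨γ, hγ⟩ := h b l hl
    have hmem : ∀ x ∈ l, x.weight ∈ graphSimplex fun i : Fin (N + 1) => γ i := by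
      intro x hx
      obtain ⟨j, hj, rfl⟩ := hγ x hx
      exact weight_vertex_mem (by omega)
    refine ⟨⟨_, hmem⟩, fun x hx y hy => ?_⟩
    rw [pow_zero]
    exact dist_le_one_of_mem (hmem x hx) (hmem y hy)
  | succ M ih =>
    obtain ⟨Ψ, hΨ, h⟩ := ih
    refine ⟨_, hΨ.subdivision_comp, fun b hb l hl => ?_⟩
    obtain ⟨l', hl', hm⟩ := exists_mem_support_of_mem_map (f := subdivision) hl
    obtain ⟨⟨γ, hγ⟩, hd⟩ := h b hb l' hl'
    refine ⟨⟨γ, fun x hx => ?_⟩, ?_⟩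
    · refine convexHull_min ?_ (convex_graphSimplex γ) (mem_convexHull_of_mem_subdivision hm x hx)
      rintro _ ⟨t, ht, rfl⟩
      exact hγ t ht
    · rw [pow_succ']
      have h1 : l'.length = _ := (Finsupp.mem_supported _ _).1 (hΨ.mem b) hl'
      exact dist_le_of_mem_subdivision (by omega) hd hm

end Fine

section Winding

variable {S : Type*} {F : S → ℂ}

lemma winding_eq_zero (hF : ∀ s, F s ≠ 0) {x y z : S} (hy : ‖F y - F x‖ < ‖F x‖)
    (hz : ‖F z - F x‖ < ‖F x‖) : winding F x y z = 0 := by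
  have key : ∀ {t}, ‖F t - F x‖ < ‖F x‖ → |turn F x t| < Real.pi / 2 := by
    intro t ht
    refine Complex.abs_arg_lt_pi_div_two_iff.2 (Or.inl ?_)
    have h1 : ‖F t / F x - 1‖ < 1 := by
      rw [div_sub_one (hF x), norm_div, div_lt_one (norm_pos_iff.2 (hF x))]
      exact ht
    have h2 := (abs_lt.1 ((Complex.abs_re_le_norm _).trans_lt h1)).1
    rw [Complex.sub_re, Complex.one_re] at h2
    linarith
  have h1 := abs_lt.1 (key hy)
  have h2 := abs_lt.1 (key hz)
  have h3 : turn F y z = turn F x z - turn F x y := by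
    have h4 : F z / F y = F z / F x * (F y / F x)⁻¹ := by
      have := hF x
      have := hF y
      field_simp
    have h5 : ((F y / F x)⁻¹).arg = -(F y / F x).arg := by
      rw [Complex.arg_inv, if_neg]
      have := h1.2
      rw [turn] at this
      linarith [Real.pi_pos]
    rw [turn, h4, Complex.arg_mul (div_ne_zero (hF z) (hF x)) (inv_ne_zero (div_ne_zero (hF y) (hF x))),
      h5]
    · rfl
    · rw [h5]
      change turn F x z + -turn F x y ∈ _
      constructor <;> linarith
  rw [winding, h3]
  simp

lemma exists_winding_ne_zero {Fs : List (S → ℂ)} {l : List S} (h : cupEval Fs (single l 1) ≠ 0) :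
    ∀ F ∈ Fs, ∃ x ∈ l, ∃ y ∈ l, ∃ z ∈ l, winding F x y z ≠ 0 := by
  induction Fs generalizing l with
  | nil => simp
  | cons F Fs ih =>
    rw [cupEval, LinearMap.comp_apply, cap_single] at h
    match l, h with
    | [], h => simp [listCap] at h
    | [x], h => simp [listCap] at h
    | [x, y], h => simp [listCap] at h
    | x :: y :: z :: l, h =>
      have hs : single (z :: l) (winding F x y z) = winding F x y z • single (z :: l) (1 : ℤ) := by
        simp
      rw [listCap, hs, map_smul, smul_eq_mul] at h
      intro F' hF'
      rcases List.mem_cons.1 hF' with rfl | hF'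
      · exact ⟨x, by simp, y, by simp, z, by simp, left_ne_zero_of_mul h⟩
      · obtain ⟨a, ha, b, hb, c, hc, h'⟩ := ih (right_ne_zero_of_mul h) F' hF'
        have hsub : ∀ {t}, t ∈ z :: l → t ∈ x :: y :: z :: l := fun ht =>
          List.mem_cons_of_mem _ (List.mem_cons_of_mem _ ht)
        exact ⟨a, hsub ha, b, hsub hb, c, hsub hc, h'⟩

end Winding

section Zeros

variable {k p : ℕ}

open MvPolynomial in
lemma exists_coeff_prod_linear_ne_zero [Fact p.Prime] (vs : List (Fin k → ZMod p))
    (hvs : ∀ v ∈ vs, v ≠ 0) : ∃ a : Fin k →₀ ℕ, ∑ i, a i = vs.length ∧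
      coeff a (vs.map fun v => ∑ i, C (v i) * X i).prod ≠ 0 := by
  have h0 : (vs.map fun v => ∑ i, C (v i) * X i).prod ≠ (0 : MvPolynomial (Fin k) (ZMod p)) := by
    refine List.prod_ne_zero fun h => ?_
    obtain ⟨v, hv, h⟩ := List.mem_map.1 h
    refine hvs v hv (funext fun i => ?_)
    have h1 := congrArg (coeff (single i 1)) h
    rw [coeff_sum, Finset.sum_eq_single i] at h1
    · simpa using h1
    · intro j _ hj
      rw [coeff_C_mul, coeff_X, if_neg, mul_zero]
      intro h
      exact hj (Finsupp.single_left_injective one_ne_zero h)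
    · simp
  have hh : (vs.map fun v => (∑ i, C (v i) * X i : MvPolynomial (Fin k) (ZMod p))).prod.IsHomogeneous
      vs.length := by
    clear h0 hvs
    induction vs with
    | nil => simpa using isHomogeneous_one _ _
    | cons v vs ih =>
      rw [List.map_cons, List.prod_cons, List.length_cons, add_comm]
      exact (IsHomogeneous.sum _ _ _ fun i _ => isHomogeneous_C_mul_X _ _).mul ih
  obtain ⟨a, ha⟩ := exists_coeff_ne_zero h0
  refine ⟨a, ?_, ha⟩
  by_contra hne
  refine ha (hh.coeff_eq_zero ?_)
  rwa [Finsupp.degree_eq_sum]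

variable [NeZero p]

lemma char_add (v g h : Fin k → ZMod p) : char v (g + h) = char v g * char v h := by
  rw [char, dotProduct_add, AddChar.map_add_eq_mul, char, char]

lemma char_ne_zero (v g : Fin k → ZMod p) : char v g ≠ 0 := by
  rw [char, ZMod.stdAddChar_apply]
  exact Circle.coe_ne_zero _

variable {n : ℕ}

/-- A function of the weights, replaced by a character of the label where it vanishes. -/
noncomputable def nonvanishing (c : (Fin k → ZMod p) × (((Fin k → ZMod p) → Fin n → ℝ) → ℂ))
    (s : Pt (Fin k → ZMod p) n) : ℂ :=
  if c.2 s.weight = 0 then char c.1 s.label else c.2 s.weight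

lemma isEquivariant_nonvanishing
    {c : (Fin k → ZMod p) × (((Fin k → ZMod p) → Fin n → ℝ) → ℂ)}
    (hc : ∀ g w, c.2 (fun h => w (h - g)) = char c.1 g * c.2 w) :
    IsEquivariant (char c.1) (nonvanishing c) where
  ne_zero s := by
    rw [nonvanishing]
    split_ifs with h
    · exact char_ne_zero _ _
    · exact h
  vadd g s := by
    have h1 : c.2 (g +ᵥ s).weight = char c.1 g * c.2 s.weight := hc g s.weight
    rw [nonvanishing, nonvanishing, h1, label_vadd, char_add]
    simp only [mul_eq_zero, char_ne_zero, false_or]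
    split_ifs <;> rfl

lemma norm_lt_of_nonvanishing {c : (Fin k → ZMod p) × (((Fin k → ZMod p) → Fin n → ℝ) → ℂ)}
    {η : ℝ} (hη : 0 < η) {x y : Pt (Fin k → ZMod p) n}
    (h : ‖nonvanishing c x‖ ≤ ‖nonvanishing c y - nonvanishing c x‖)
    (hxy : ‖c.2 y.weight - c.2 x.weight‖ < η) : ‖c.2 x.weight‖ < η := by
  by_cases hx : c.2 x.weight = 0
  · simpa [hx] using hη
  by_cases hy : c.2 y.weight = 0
  · simpa [hy] using hxy
  rw [nonvanishing, nonvanishing, if_neg hx, if_neg hy] at h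
  exact h.trans_lt hxy

/-- The union of the simplices `graphSimplex γ`. -/
def graphComplex (k p n : ℕ) [NeZero p] : Set ((Fin k → ZMod p) → Fin n → ℝ) := ⋃ γ, graphSimplex γ

lemma isCompact_graphComplex : IsCompact (graphComplex k p n) := by
  refine isCompact_iUnion fun γ => Metric.isCompact_of_isClosed_isBounded ?_ ?_
  · simp only [graphSimplex, Set.ofPred_and, Set.ofPred_forall]
    refine IsClosed.inter ?_ (IsClosed.inter ?_ ?_)
    · exact isClosed_iInter fun g => isClosed_iInter fun i =>
        isClosed_le continuous_const (by fun_prop)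
    · exact isClosed_iInter fun g => isClosed_iInter fun i => isClosed_iInter fun _ =>
        isClosed_eq (by fun_prop) continuous_const
    · exact isClosed_eq (by fun_prop) continuous_const
  · exact Metric.isBounded_iff.2 ⟨1, fun x hx y hy => dist_le_one_of_mem hx hy⟩

set_option maxHeartbeats 1000000 in
/-- Equivariant functions on the graph complex have a common zero. -/
theorem exists_common_zero [Fact p.Prime] {N : ℕ}
    (Cs : List ((Fin k → ZMod p) × (((Fin k → ZMod p) → Fin (N + 1) → ℝ) → ℂ)))
    (hN : 2 * Cs.length ≤ N) (hne : ∀ c ∈ Cs, c.1 ≠ 0)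
    (hcont : ∀ c ∈ Cs, ContinuousOn c.2 (graphComplex k p (N + 1)))
    (hequiv : ∀ c ∈ Cs, ∀ g w, c.2 (fun h => w (h - g)) = char c.1 g * c.2 w) :
    ∃ w ∈ graphComplex k p (N + 1), ∀ c ∈ Cs, c.2 w = 0 := by
  by_contra! hzero
  have hmem0 : (vertex (N + 1) (0 : Fin k → ZMod p) 0).weight ∈ graphComplex k p (N + 1) :=
    Set.mem_iUnion.2 ⟨_, weight_vertex_mem (k := k) (p := p) (γ := fun _ => 0) (Nat.succ_pos N)⟩
  obtain ⟨w₀, hw₀, hmin⟩ := isCompact_graphComplex.exists_isMinOn ⟨_, hmem0⟩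
    (continuousOn_list_sum Cs fun c hc => (hcont c hc).norm)
  set ε := (Cs.map fun c => ‖c.2 w₀‖).sum with hε
  have hεpos : 0 < ε := by
    obtain ⟨c, hc, h⟩ := hzero w₀ hw₀
    refine (norm_pos_iff.2 h).trans_le (List.single_le_sum ?_ _ (List.mem_map_of_mem hc))
    intro x hx
    obtain ⟨c, _, rfl⟩ := List.mem_map.1 hx
    exact norm_nonneg _
  set η := ε / (2 * (Cs.length + 1)) with hη
  have hηpos : 0 < η := by positivity
  obtain ⟨δ, hδ, hδc⟩ : ∃ δ > 0, ∀ c ∈ Cs, ∀ x ∈ graphComplex k p (N + 1),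
      ∀ y ∈ graphComplex k p (N + 1), dist x y < δ → dist (c.2 x) (c.2 y) < η := by
    have h1 : ∀ c ∈ {c | c ∈ Cs}, ∀ᶠ δ in nhdsWithin (0 : ℝ) (Set.Ioi 0),
        ∀ x ∈ graphComplex k p (N + 1), ∀ y ∈ graphComplex k p (N + 1),
          dist x y < δ → dist (c.2 x) (c.2 y) < η := by
      intro c hc
      obtain ⟨δ, hδ, h⟩ := Metric.uniformContinuousOn_iff.1
        (isCompact_graphComplex.uniformContinuousOn_of_continuous (hcont c hc)) η hηpos
      filter_upwards [Ioo_mem_nhdsGT hδ] with δ' hδ' x hx y hy hxy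
      exact h x hx y hy (hxy.trans hδ'.2)
    obtain ⟨δ, h2, h3⟩ := (((Filter.eventually_all_finite (List.finite_toSet Cs)).2 h1).and
      self_mem_nhdsWithin).exists
    exact ⟨δ, h3, h2⟩
  obtain ⟨Ψ, hΨ, hfine⟩ := exists_fine_comparison k p N hδ
  obtain ⟨a, ha, hcoeff⟩ := exists_coeff_prod_linear_ne_zero (Cs.map Prod.fst) (by
    intro v hv
    obtain ⟨c, hc, rfl⟩ := List.mem_map.1 hv
    exact hne c hc)
  rw [List.length_map] at ha
  have hmap := hΨ.cupEval_map (Cs.map fun c => (c.1, nonvanishing c)) (by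
    intro c hc
    obtain ⟨c', hc', rfl⟩ := List.mem_map.1 hc
    exact isEquivariant_nonvanishing (hequiv c' hc')) a
  simp only [List.map_map, Function.comp_def] at hmap hcoeff
  have hcup : cupEval (Cs.map nonvanishing) (Ψ (single (fun i => 2 * a i, 0) 1)) ≠ 0 := by
    intro h
    rw [h, Int.cast_zero] at hmap
    exact hcoeff hmap.symm
  have hcup' : ∃ l ∈ (Ψ (single (fun i => 2 * a i, 0) 1)).support,
      cupEval (Cs.map nonvanishing) (single l 1) ≠ 0 := by
    by_contra! h
    exact hcup (linearMap_eq_of_single_of_mem (f := cupEval (Cs.map nonvanishing)) (g := 0) h)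
  obtain ⟨l, hl, hlne⟩ := hcup'
  have hdeg : degree ((fun i => 2 * a i, 0) : Cell k p) = 2 * Cs.length := by
    rw [degree, ← ha, Finset.mul_sum]
  obtain ⟨⟨γ, hγ⟩, hdist⟩ := hfine _ (hdeg.trans_le hN) l hl
  have hX : ∀ x ∈ l, x.weight ∈ graphComplex k p (N + 1) := fun x hx =>
    Set.mem_iUnion.2 ⟨γ, hγ x hx⟩
  have hlen : l.length = _ := (Finsupp.mem_supported _ _).1 (hΨ.mem _) hl
  obtain ⟨s, hs⟩ := List.exists_mem_of_length_pos (hlen.symm ▸ Nat.succ_pos _ : 0 < l.length)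
  have hsmall : ∀ c ∈ Cs, ‖c.2 s.weight‖ ≤ 2 * η := by
    intro c hc
    obtain ⟨x, hx, y, hy, z, hz, hw⟩ := exists_winding_ne_zero hlne _ (List.mem_map_of_mem hc)
    have hF := (isEquivariant_nonvanishing (hequiv c hc)).ne_zero
    have hclose : ∀ {y x}, y ∈ l → x ∈ l → ‖c.2 y.weight - c.2 x.weight‖ < η := fun hy hx => by
      rw [← dist_eq_norm]
      exact hδc c hc _ (hX _ hy) _ (hX _ hx) (hdist _ hy _ hx)
    have hxs : ‖c.2 x.weight‖ < η := by
      by_contra hxs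
      refine hw (winding_eq_zero hF ?_ ?_)
      · by_contra! h
        exact hxs (norm_lt_of_nonvanishing hηpos h (hclose hy hx))
      · by_contra! h
        exact hxs (norm_lt_of_nonvanishing hηpos h (hclose hz hx))
    have h1 := norm_add_le (c.2 s.weight - c.2 x.weight) (c.2 x.weight)
    rw [sub_add_cancel] at h1
    linarith [hclose hs hx]
  have hsum : ε ≤ (Cs.map fun c => ‖c.2 s.weight‖).sum := hmin (hX s hs)
  have hsum' := List.sum_le_card_nsmul (Cs.map fun c => ‖c.2 s.weight‖) (2 * η) (by
    intro x hx
    obtain ⟨c, hc, rfl⟩ := List.mem_map.1 hx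
    exact hsmall c hc)
  rw [List.length_map, nsmul_eq_mul] at hsum'
  have h1 : 2 * η * (Cs.length + 1) = ε := by
    rw [hη]
    field_simp
  have h2 : (Cs.length : ℝ) * (2 * η) + 2 * η = ε := by
    rw [← h1]
    ring
  linarith

end Zeros

section Orthogonality

variable {k p : ℕ} [NeZero p]

lemma sum_char_left (g : Fin k → ZMod p) :
    ∑ v, char v g = if g = 0 then (Fintype.card (Fin k → ZMod p) : ℂ) else 0 := by
  let ψ : AddChar (Fin k → ZMod p) ℂ :=
    { toFun := fun v => char v g
      map_zero_eq_one' := by simp [char]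
      map_add_eq_mul' := fun v v' => by simp [char, add_dotProduct, AddChar.map_add_eq_mul] }
  have hψ : ∑ v, char v g = ∑ v, ψ v := rfl
  split_ifs with hg
  · simp [hg, char]
  · rw [hψ]
    refine AddChar.sum_eq_zero_of_ne_one fun h => hg (funext fun i => ?_)
    have h1 : char (Pi.single i 1) g = 1 := congrArg (fun χ => χ (Pi.single i 1)) h
    rw [char, single_one_dotProduct] at h1
    exact ZMod.injective_stdAddChar (h1.trans (AddChar.map_zero_eq_one _).symm)

/-- The Fourier coefficients of a function on the group. -/
noncomputable def fourier (v : Fin k → ZMod p) (a : (Fin k → ZMod p) → ℂ) : ℂ :=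
  ∑ g, char v g * a g

lemma fourier_shift (v g : Fin k → ZMod p) (a : (Fin k → ZMod p) → ℂ) :
    fourier v (fun h => a (h - g)) = char v g * fourier v a := by
  rw [fourier, fourier, Finset.mul_sum, ← Equiv.sum_comp (Equiv.addRight g)]
  refine Finset.sum_congr rfl fun h _ => ?_
  rw [Equiv.coe_addRight, add_sub_cancel_right, char_add]
  ring

lemma eq_of_fourier_eq_zero {a : (Fin k → ZMod p) → ℂ} (h : ∀ v ≠ 0, fourier v a = 0)
    (g g' : Fin k → ZMod p) : a g = a g' := by
  have key : ∀ g, (Fintype.card (Fin k → ZMod p) : ℂ) * a g = fourier 0 a := by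
    intro g
    have h1 : ∑ v, char v (-g) * fourier v a = fourier 0 a := by
      rw [Finset.sum_eq_single 0]
      · simp [char]
      · intro v _ hv
        rw [h v hv, mul_zero]
      · simp
    have h2 : ∀ v, char v (-g) * fourier v a = ∑ g', char v (g' - g) * a g' := by
      intro v
      rw [fourier, Finset.mul_sum]
      refine Finset.sum_congr rfl fun g' _ => ?_
      rw [sub_eq_neg_add, char_add, mul_assoc]
    rw [← h1, Finset.sum_congr rfl fun v _ => h2 v, Finset.sum_comm]
    simp only [← Finset.sum_mul, sum_char_left, sub_eq_zero]
    simp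
  have h0 : (Fintype.card (Fin k → ZMod p) : ℂ) ≠ 0 := Nat.cast_ne_zero.2 Fintype.card_ne_zero
  exact mul_left_cancel₀ h0 ((key g).trans (key g').symm)

end Orthogonality

section Tverberg

variable {k p : ℕ} [Fact p.Prime]

/-- For enough levels, `d` continuous functions of the levels take, at some point of the graph
complex, values which do not depend on the sheet. -/
theorem exists_forall_eq {N d : ℕ} (hN : 2 * (d * (p ^ k - 1)) ≤ N)
    (H : Fin d → (Fin (N + 1) → ℝ) → ℂ) (hH : ∀ c, ContinuousOn (H c) {u | ∀ i, 0 ≤ u i}) :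
    ∃ w ∈ graphComplex k p (N + 1), ∀ c g g', H c (w g) = H c (w g') := by
  classical
  let T : Finset ((Fin k → ZMod p) × Fin d) := Finset.univ.erase 0 ×ˢ Finset.univ
  let F : (Fin k → ZMod p) × Fin d →
      (Fin k → ZMod p) × (((Fin k → ZMod p) → Fin (N + 1) → ℝ) → ℂ) :=
    fun t => (t.1, fun w => fourier t.1 fun g => H t.2 (w g))
  have hlen : 2 * (T.toList.map F).length ≤ N := by
    rw [mul_comm d] at hN
    simpa [T, Finset.card_product, Finset.card_erase_of_mem, ZMod.card] using hN
  have hne : ∀ c ∈ T.toList.map F, c.1 ≠ 0 := by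
    intro c hc
    obtain ⟨t, ht, rfl⟩ := List.mem_map.1 hc
    exact (Finset.mem_erase.1 (Finset.mem_product.1 (Finset.mem_toList.1 ht)).1).1
  obtain ⟨w, hw, h⟩ := exists_common_zero (T.toList.map F) hlen hne (by
    intro c hc
    obtain ⟨t, ht, rfl⟩ := List.mem_map.1 hc
    refine continuousOn_finsetSum _ fun g _ => continuousOn_const.mul ?_
    refine (hH t.2).comp (continuous_apply g).continuousOn fun w hw => ?_
    obtain ⟨γ, hγ⟩ := Set.mem_iUnion.1 hw
    exact hγ.1 g) (by
    intro c hc g w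
    obtain ⟨t, ht, rfl⟩ := List.mem_map.1 hc
    exact fourier_shift t.1 g fun h => H t.2 (w h))
  refine ⟨w, hw, fun c g g' => eq_of_fourier_eq_zero (a := fun g => H c (w g)) ?_ g g'⟩
  intro v hv
  exact h (F (v, c)) (List.mem_map_of_mem (by simp [T, hv]))

/-- The homogeneous extension of a function on the simplex. -/
noncomputable def homExt {ι : Type*} [Fintype ι] (f : (ι → ℝ) → ℂ) (u : ι → ℝ) : ℂ :=
  (∑ i, u i) • f ((∑ i, u i)⁻¹ • u)

lemma inv_sum_smul_mem_stdSimplex {ι : Type*} [Fintype ι] {u : ι → ℝ} (hu : ∀ i, 0 ≤ u i)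
    (h : ∑ i, u i ≠ 0) : (∑ i, u i)⁻¹ • u ∈ stdSimplex ℝ ι := by
  refine ⟨fun i => mul_nonneg (inv_nonneg.2 (Finset.sum_nonneg fun i _ => hu i)) (hu i), ?_⟩
  simp only [Pi.smul_apply, smul_eq_mul, ← Finset.mul_sum]
  exact inv_mul_cancel₀ h

lemma continuousOn_homExt {ι : Type*} [Fintype ι] {f : (ι → ℝ) → ℂ}
    (hf : ContinuousOn f (stdSimplex ℝ ι)) : ContinuousOn (homExt f) {u | ∀ i, 0 ≤ u i} := by
  intro u hu
  have hsum : Continuous fun u : ι → ℝ => ∑ i, u i := by fun_prop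
  by_cases h : ∑ i, u i = 0
  · obtain ⟨B, hB⟩ := (isCompact_stdSimplex ℝ ι).exists_bound_of_continuousOn hf
    have hbound : ∀ u ∈ {u : ι → ℝ | ∀ i, 0 ≤ u i}, ‖homExt f u‖ ≤ (∑ i, u i) * B := by
      intro u hu
      by_cases h : ∑ i, u i = 0
      · simp [homExt, h]
      · rw [homExt, norm_smul, Real.norm_of_nonneg (Finset.sum_nonneg fun i _ => hu i)]
        exact mul_le_mul_of_nonneg_left (hB _ (inv_sum_smul_mem_stdSimplex hu h))
          (Finset.sum_nonneg fun i _ => hu i)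
    have h0 : homExt f u = 0 := by simp [homExt, h]
    rw [ContinuousWithinAt, h0]
    refine squeeze_zero_norm' (eventually_nhdsWithin_of_forall hbound) ?_
    have h1 := (hsum.mul_const B).tendsto u
    rw [h, zero_mul] at h1
    exact h1.mono_left nhdsWithin_le_nhds
  · refine hsum.continuousWithinAt.smul ?_
    have h1 : ContinuousWithinAt (fun u : ι → ℝ => (∑ i, u i)⁻¹ • u) {u | ∀ i, 0 ≤ u i} u :=
      (hsum.continuousWithinAt.inv₀ h).smul continuousWithinAt_id
    refine (hf _ (inv_sum_smul_mem_stdSimplex hu h)).tendsto.comp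
      (tendsto_nhdsWithin_iff.2 ⟨h1.tendsto, ?_⟩)
    filter_upwards [nhdsWithin_le_nhds (hsum.continuousAt.eventually_ne h), self_mem_nhdsWithin]
      with v hv hv' using inv_sum_smul_mem_stdSimplex hv' hv

/-- The topological Tverberg theorem in the plane, with the faces indexed by an elementary abelian
group. -/
theorem exists_disjoint_faces {m l N : ℕ} (e : Fin m ⊕ Fin l ≃ Fin (N + 1)) (hl : l < p ^ k)
    (hN : 4 * (p ^ k - 1) ≤ N) {f : (Fin m → ℝ) → ℂ} (hf : ContinuousOn f (stdSimplex ℝ (Fin m))) :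
    ∃ A : (Fin k → ZMod p) → Set (Fin m), (∀ s, (A s).Nonempty) ∧
      (∀ s t, s ≠ t → Disjoint (A s) (A t)) ∧
      ∃ x : (Fin k → ZMod p) → Fin m → ℝ, (∀ s, x s ∈ stdSimplex ℝ (Fin m)) ∧
        (∀ s, ∀ i ∉ A s, x s i = 0) ∧ ∀ s t, f (x s) = f (x t) := by
  let q : (Fin (N + 1) → ℝ) → Fin m → ℝ := fun u i => u (e (Sum.inl i))
  let z : (Fin (N + 1) → ℝ) → ℝ := fun u => ∑ j, u (e (Sum.inr j))
  obtain ⟨w, hw, h⟩ := exists_forall_eq (k := k) (p := p) (N := N) (d := 2) (by omega)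
    ![fun u => ⟨∑ i, q u i, z u⟩, fun u => homExt f (q u)] (by
      intro c
      fin_cases c
      · have h1 : Continuous fun u : Fin (N + 1) → ℝ =>
            ((∑ i, q u i : ℝ) : ℂ) + (z u : ℝ) * Complex.I := by
          fun_prop
        refine h1.continuousOn.congr fun u _ => ?_
        exact Complex.mk_eq_add_mul_I _ _
      · exact (continuousOn_homExt hf).comp (by fun_prop) fun u hu i => hu _)
  have hq : ∀ g g', ∑ i, q (w g) i = ∑ i, q (w g') i := fun g g' => congrArg Complex.re (h 0 g g')
  have hz : ∀ g g', z (w g) = z (w g') := fun g g' => congrArg Complex.im (h 0 g g')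
  have hc : ∀ g g', homExt f (q (w g)) = homExt f (q (w g')) := fun g g' => h 1 g g'
  obtain ⟨γ, hpos, hγ, hsum⟩ := Set.mem_iUnion.1 hw
  have hz0 : ∀ g, z (w g) = 0 := by
    obtain ⟨g, hg⟩ : ∃ g, ∀ j, γ (e (Sum.inr j)) ≠ g := by
      by_contra! hsurj
      have := Fintype.card_le_of_surjective _ hsurj
      simp [ZMod.card] at this
      omega
    intro g'
    rw [hz g' g]
    exact Finset.sum_eq_zero fun j _ => hγ g _ (hg j).symm
  have hτ : ∀ g, ∑ i, q (w g) i ≠ 0 := by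
    intro g hg
    refine zero_ne_one (hsum.symm.trans ?_).symm
    refine Finset.sum_eq_zero fun g' _ => ?_
    rw [← e.sum_comp, Fintype.sum_sum_type]
    change ∑ i, q (w g') i + z (w g') = 0
    rw [hq g' g, hg, hz0, add_zero]
  refine ⟨fun g => {i | q (w g) i ≠ 0}, fun g => ?_, fun s t hst => ?_,
    fun g => (∑ i, q (w g) i)⁻¹ • q (w g),
    fun g => inv_sum_smul_mem_stdSimplex (fun i => hpos g _) (hτ g), fun g i hi => ?_,
    fun s t => ?_⟩
  · obtain ⟨i, _, hi⟩ := Finset.exists_ne_zero_of_sum_ne_zero (hτ g)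
    exact ⟨i, hi⟩
  · refine Set.disjoint_left.2 fun i hi hi' => hst ?_
    by_contra
    have h1 : s = γ (e (Sum.inl i)) := by_contra fun h => hi (hγ s _ h)
    have h2 : t = γ (e (Sum.inl i)) := by_contra fun h => hi' (hγ t _ h)
    exact hst (h1.trans h2.symm)
  · have hi : q (w g) i = 0 := by_contra hi
    simp [hi]
  · have h1 := hc s t
    rw [homExt, homExt, hq s t] at h1
    dsimp only
    rw [hq s t]
    exact smul_right_injective ℂ (hτ t) h1

end Tverberg

end PlanarTverberg

/-- Topological Tverberg theorem in the plane, for prime powers: if `r` is a prime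
power, then for every continuous map of the `(3r-3)`-simplex to the plane there exist
`r` pairwise disjoint faces whose images have a common point. -/
theorem stmt_14 (r : ℕ) (hr : ∃ q m : ℕ, Nat.Prime q ∧ 1 ≤ m ∧ r = q ^ m)
    (f : (Fin (3 * r - 2) → ℝ) → EuclideanSpace ℝ (Fin 2))
    (hf : ContinuousOn f (stdSimplex ℝ (Fin (3 * r - 2)))) :
    ∃ A : Fin r → Set (Fin (3 * r - 2)),
      (∀ s : Fin r, (A s).Nonempty) ∧
      (∀ s t : Fin r, s ≠ t → Disjoint (A s) (A t)) ∧
      (⋂ s : Fin r,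
        f '' {x ∈ stdSimplex ℝ (Fin (3 * r - 2)) | ∀ i ∉ A s, x i = 0}).Nonempty := by
  obtain ⟨q, m, hq, -, hrq⟩ := hr
  have := Fact.mk hq
  have hrpos : 0 < r := hrq ▸ pow_pos hq.pos m
  let φ : EuclideanSpace ℝ (Fin 2) ≃ₗᵢ[ℝ] ℂ := Complex.orthonormalBasisOneI.repr.symm
  obtain ⟨A, hA, hdisj, x, hx, hxA, hfx⟩ := PlanarTverberg.exists_disjoint_faces (k := m) (p := q)
    (m := 3 * r - 2) (l := r - 1) (N := 4 * (r - 1)) (f := fun x => φ (f x))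
    (finSumFinEquiv.trans (finCongr (by omega))) (by omega) (by omega)
    (φ.continuous.comp_continuousOn hf)
  let E : Fin r ≃ (Fin m → ZMod q) := (Fintype.equivFinOfCardEq (by simp [ZMod.card, hrq])).symm
  refine ⟨fun s => A (E s), fun s => hA _, fun s t hst => hdisj _ _ (E.injective.ne hst),
    f (x 0), Set.mem_iInter.2 fun s => ⟨x (E s), ⟨hx _, hxA _⟩, φ.injective (hfx _ _)⟩⟩
end
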